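/- Let A be a commutative ring, m ≥ 3 an integer, and f ∈ A[t] a monic polynomial. If g ∈ SL_m(A[t]) is such that its image in SL_m(A[t]_f) under the localization homomorphism A[t] → A[t]_f lies in E_m(A[t]_f), then g ∈ E_m(A[t]). Equivalently, the natural homomorphism K1^{SL_m}(A[t]) → K1^{SL_m}(A[t]_f) is injective. -/

import Mathlib

open Matrix

/-- The elementary subgroup `E_m(S)` of `SL_m(S)`. -/
def ElemSubgroup (m : ℕ) (S : Type*) [CommRing S] :
    Subgroup (SpecialLinearGroup (Fin m) S) :=
  Subgroup.closure { g | ∃ i j : Fin m, ∃ a : S, i ≠ j ∧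
    (g : Matrix (Fin m) (Fin m) S) = Matrix.transvection i j a }

/-- The multiplicative monoid of matrices generated by the elementary matrices. -/
def elemMonoid (m : ℕ) (S : Type*) [CommRing S] : Submonoid (Matrix (Fin m) (Fin m) S) :=
  Submonoid.closure { M | ∃ i j : Fin m, ∃ a : S, i ≠ j ∧ M = Matrix.transvection i j a }

section Elementary

variable {m : ℕ} {S : Type*} [CommRing S]

theorem transvection_mem_elemMonoid {i j : Fin m} (h : i ≠ j) (a : S) :
    transvection i j a ∈ elemMonoid m S :=
  Submonoid.subset_closure ⟨i, j, a, h, rfl⟩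

theorem exists_mem_elemSubgroup_of_mem_elemMonoid {M : Matrix (Fin m) (Fin m) S}
    (hM : M ∈ elemMonoid m S) :
    ∃ g ∈ ElemSubgroup m S, (g : Matrix (Fin m) (Fin m) S) = M := by
  induction hM using Submonoid.closure_induction with
  | mem x hx =>
    obtain ⟨i, j, a, h, rfl⟩ := hx
    exact ⟨⟨transvection i j a, det_transvection_of_ne i j h a⟩,
      Subgroup.subset_closure ⟨i, j, a, h, rfl⟩, rfl⟩
  | one => exact ⟨1, one_mem _, rfl⟩
  | mul x y _ _ hx hy =>
    obtain ⟨g, hg, rfl⟩ := hx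
    obtain ⟨k, hk, rfl⟩ := hy
    exact ⟨g * k, mul_mem hg hk, rfl⟩

theorem mem_elemSubgroup_iff {g : SpecialLinearGroup (Fin m) S} :
    g ∈ ElemSubgroup m S ↔ (g : Matrix (Fin m) (Fin m) S) ∈ elemMonoid m S := by
  constructor
  · intro hg
    induction hg using Subgroup.closure_induction'' with
    | mem x hx =>
      obtain ⟨i, j, a, h, hx⟩ := hx
      exact hx ▸ transvection_mem_elemMonoid h a
    | inv_mem x hx =>
      obtain ⟨i, j, a, h, hx⟩ := hx
      have : x⁻¹ = (⟨transvection i j (-a), det_transvection_of_ne i j h (-a)⟩ :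
          SpecialLinearGroup (Fin m) S) := by
        refine inv_eq_of_mul_eq_one_right (Subtype.ext ?_)
        change (x : Matrix (Fin m) (Fin m) S) * transvection i j (-a) = 1
        simp [hx, transvection_mul_transvection_same i j h]
      rw [this]
      exact transvection_mem_elemMonoid h _
    | one => exact one_mem _
    | mul x y _ _ hx hy => exact mul_mem hx hy
  · intro hg
    obtain ⟨k, hk, h⟩ := exists_mem_elemSubgroup_of_mem_elemMonoid hg
    rwa [← Subtype.ext h]

theorem exists_inverse_of_mem_elemMonoid {M : Matrix (Fin m) (Fin m) S}
    (hM : M ∈ elemMonoid m S) : ∃ N ∈ elemMonoid m S, M * N = 1 ∧ N * M = 1 := by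
  obtain ⟨g, hg, rfl⟩ := exists_mem_elemSubgroup_of_mem_elemMonoid hM
  exact ⟨_, mem_elemSubgroup_iff.1 (inv_mem hg), congrArg Subtype.val (mul_inv_cancel g),
    congrArg Subtype.val (inv_mul_cancel g)⟩

theorem mapMatrix_transvection {S' : Type*} [CommRing S'] (φ : S →+* S') (i j : Fin m) (a : S) :
    φ.mapMatrix (transvection i j a) = transvection i j (φ a) := by
  ext p q
  simp only [transvection, RingHom.mapMatrix_apply, Matrix.map_apply, Matrix.add_apply, map_add,
    Matrix.one_apply, Matrix.single_apply]
  split_ifs <;> simp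

theorem mapMatrix_mem_elemMonoid {S' : Type*} [CommRing S'] (φ : S →+* S')
    {M : Matrix (Fin m) (Fin m) S} (hM : M ∈ elemMonoid m S) :
    φ.mapMatrix M ∈ elemMonoid m S' := by
  induction hM using Submonoid.closure_induction with
  | mem x hx =>
    obtain ⟨i, j, a, h, rfl⟩ := hx
    rw [mapMatrix_transvection]
    exact transvection_mem_elemMonoid h _
  | one => rw [map_one]; exact one_mem _
  | mul x y _ _ hx hy => rw [map_mul]; exact mul_mem hx hy

theorem mem_elemMonoid_of_mul_mem_left {M N : Matrix (Fin m) (Fin m) S}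
    (hN : N ∈ elemMonoid m S) (h : N * M ∈ elemMonoid m S) : M ∈ elemMonoid m S := by
  obtain ⟨N', hN', -, h1⟩ := exists_inverse_of_mem_elemMonoid hN
  have := mul_mem hN' h
  rwa [← mul_assoc, h1, one_mul] at this

theorem transpose_mem_elemMonoid {M : Matrix (Fin m) (Fin m) S} (hM : M ∈ elemMonoid m S) :
    Mᵀ ∈ elemMonoid m S := by
  induction hM using Submonoid.closure_induction with
  | mem x hx =>
    obtain ⟨i, j, a, h, rfl⟩ := hx
    have : (transvection i j a)ᵀ = transvection j i a := by
      simp [transvection, transpose_add, transpose_single]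
    rw [this]
    exact transvection_mem_elemMonoid h.symm _
  | one => rw [transpose_one]; exact one_mem _
  | mul x y _ _ hx hy => rw [transpose_mul]; exact mul_mem hy hx

/-- The matrix that differs from the identity by the vector `w` added to its `i`-th column. -/
def colMatrix (i : Fin m) (w : Fin m → S) : Matrix (Fin m) (Fin m) S :=
  1 + vecMulVec w (Pi.single i 1)

theorem colMatrix_apply (i : Fin m) (w : Fin m → S) (a b : Fin m) :
    colMatrix i w a b = (1 : Matrix (Fin m) (Fin m) S) a b + if b = i then w a else 0 := by
  simp [colMatrix, vecMulVec_apply, Pi.single_apply]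

theorem transvection_eq_colMatrix (i j : Fin m) (x : S) :
    transvection i j x = colMatrix j (Pi.single i x) := by
  ext p q
  rw [colMatrix_apply, transvection, Matrix.add_apply, Matrix.single_apply]
  congr 1
  by_cases hp : i = p <;> by_cases hq : j = q <;> simp [hp, hq, eq_comm]

theorem colMatrix_mul_colMatrix (i : Fin m) (w w' : Fin m → S) (hw' : w' i = 0) :
    colMatrix i w * colMatrix i w' = colMatrix i (w + w') := by
  simp only [colMatrix, add_mul, mul_add, one_mul, mul_one, vecMulVec_mul_vecMulVec,
    add_vecMulVec]
  simp [hw', add_assoc, add_comm]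

theorem colMatrix_mem_elemMonoid (i : Fin m) (w : Fin m → S) (hw : w i = 0) :
    colMatrix i w ∈ elemMonoid m S := by
  have key : ∀ s : Finset (Fin m), i ∉ s →
      colMatrix i (∑ k ∈ s, Pi.single k (w k)) ∈ elemMonoid m S := by
    intro s
    induction s using Finset.induction_on with
    | empty => intro _; simp [colMatrix]
    | insert k s hk ih =>
      intro hi
      rw [Finset.mem_insert, not_or] at hi
      rw [Finset.sum_insert hk, ← colMatrix_mul_colMatrix]
      · refine mul_mem ?_ (ih hi.2)
        rw [← transvection_eq_colMatrix]
        exact transvection_mem_elemMonoid (Ne.symm hi.1) _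
      · rw [Finset.sum_apply]
        refine Finset.sum_eq_zero fun x hx => ?_
        exact Pi.single_eq_of_ne (by rintro rfl; exact hi.2 hx) _
  have := key (Finset.univ.erase i) (Finset.notMem_erase _ _)
  have h2 : ∑ k ∈ Finset.univ.erase i, Pi.single k (w k) = w := by
    rw [← Finset.univ_sum_single w, ← Finset.add_sum_erase _ _ (Finset.mem_univ i)]
    simp [hw]
  rwa [h2] at this

end Elementary

section Dilation

open Polynomial

/-- A ring homomorphism `φ` behaves like the localization at `S`: up to elements of `S`, every
element of the target comes from the source, and the kernel consists of `S`-torsion. -/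
structure IsFractionMap {R R' : Type*} [CommRing R] [CommRing R'] (φ : R →+* R')
    (S : Submonoid R) : Prop where
  surj : ∀ x : R', ∃ s ∈ S, ∃ c : R, φ s * x = φ c
  ker : ∀ c : R, φ c = 0 → ∃ s ∈ S, s * c = 0

theorem IsFractionMap.of_isLocalization {R R' : Type*} [CommRing R] [CommRing R'] [Algebra R R']
    (S : Submonoid R) [IsLocalization S R'] : IsFractionMap (algebraMap R R') S where
  surj x := by
    obtain ⟨⟨c, s⟩, h⟩ := IsLocalization.surj S x
    exact ⟨s, s.2, c, by rw [mul_comm]; exact h⟩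
  ker c hc := by
    obtain ⟨s, hs⟩ := (IsLocalization.map_eq_zero_iff S R' c).1 hc
    exact ⟨s, s.2, hs⟩

theorem IsFractionMap.polynomial {R R' : Type*} [CommRing R] [CommRing R'] {φ : R →+* R'}
    {S : Submonoid R} (h : IsFractionMap φ S) :
    IsFractionMap (mapRingHom φ) (S.map (C : R →+* R[X])) where
  surj x := by
    suffices H : ∃ s ∈ S, ∃ q : R[X], C (φ s) * x = q.map φ by
      obtain ⟨s, hs, q, hq⟩ := H
      exact ⟨C s, Submonoid.mem_map_of_mem _ hs, q, by simpa using hq⟩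
    induction x using Polynomial.induction_on' with
    | add p q hp hq =>
      obtain ⟨s, hs, p', hp'⟩ := hp
      obtain ⟨u, hu, q', hq'⟩ := hq
      refine ⟨s * u, mul_mem hs hu, C u * p' + C s * q', ?_⟩
      simp only [Polynomial.map_add, Polynomial.map_mul, Polynomial.map_C, ← hp', ← hq', map_mul]
      ring
    | monomial n a =>
      obtain ⟨s, hs, c, hc⟩ := h.surj a
      exact ⟨s, hs, monomial n c, by rw [C_mul_monomial, hc, Polynomial.map_monomial]⟩
  ker p hp := by
    have H : ∀ F : Finset ℕ, ∃ s ∈ S, ∀ n ∈ F, s * p.coeff n = 0 := by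
      intro F
      induction F using Finset.induction_on with
      | empty => exact ⟨1, one_mem _, by simp⟩
      | insert n F _ ih =>
        obtain ⟨s, hs, hF⟩ := ih
        obtain ⟨u, hu, hn⟩ := h.ker (p.coeff n) (by
          have := congrArg (fun q => q.coeff n) hp
          simpa using this)
        refine ⟨s * u, mul_mem hs hu, fun k hk => ?_⟩
        rcases Finset.mem_insert.1 hk with rfl | hk
        · rw [mul_assoc, hn, mul_zero]
        · rw [mul_right_comm, hF k hk, zero_mul]
    obtain ⟨s, hs, H⟩ := H p.support
    refine ⟨C s, Submonoid.mem_map_of_mem _ hs, ?_⟩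
    ext n
    by_cases hn : n ∈ p.support
    · simp [H n hn]
    · simp [notMem_support_iff.1 hn]

variable {m : ℕ}

/-- The matrices generated by the elementary matrices with off-diagonal entry in `φ (b B)`. -/
def elemMultiples (m : ℕ) {B B' : Type*} [CommRing B] [CommRing B'] (φ : B →+* B') (b : B) :
    Submonoid (Matrix (Fin m) (Fin m) B') :=
  Submonoid.closure { M | ∃ i j : Fin m, ∃ f : B, i ≠ j ∧ M = transvection i j (φ (b * f)) }

theorem transvection_mem_elemMultiples {B B' : Type*} [CommRing B] [CommRing B'] (φ : B →+* B')
    {b : B} {i j : Fin m} (h : i ≠ j) {x : B'} {f : B} (hx : x = φ (b * f)) :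
    transvection i j x ∈ elemMultiples m φ b :=
  Submonoid.subset_closure ⟨i, j, f, h, by rw [hx]⟩

theorem exists_lift_of_mem_elemMultiples {B B' : Type*} [CommRing B] [CommRing B']
    (φ : B →+* B') {b : B} {M : Matrix (Fin m) (Fin m) B'} (hM : M ∈ elemMultiples m φ b) :
    ∃ N ∈ elemMonoid m B, φ.mapMatrix N = M := by
  induction hM using Submonoid.closure_induction with
  | mem x hx =>
    obtain ⟨i, j, a, h, rfl⟩ := hx
    exact ⟨_, transvection_mem_elemMonoid h _, mapMatrix_transvection _ _ _ _⟩
  | one => exact ⟨1, one_mem _, map_one _⟩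
  | mul x y _ _ hx hy =>
    obtain ⟨g, hg, rfl⟩ := hx
    obtain ⟨k, hk, rfl⟩ := hy
    exact ⟨g * k, mul_mem hg hk, map_mul _ _ _⟩

theorem single_mul_single_eq_ite {S : Type*} [CommRing S] (i j k l : Fin m) (x y : S) :
    single i j x * single k l y = if j = k then single i l (x * y) else 0 := by
  split_ifs with h
  · subst h
    exact single_mul_single_same _ _ _ _ _
  · exact single_mul_single_of_ne _ _ _ _ h _

theorem transvection_mul_commutator {S : Type*} [CommRing S] {i l j : Fin m} (hil : i ≠ l)
    (hlj : l ≠ j) (hij : i ≠ j) (x y : S) :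
    transvection i l x * transvection l j y * transvection i l (-x) * transvection l j (-y) =
      transvection i j (x * y) := by
  simp only [transvection, mul_add, add_mul, mul_one, one_mul, single_mul_single_eq_ite,
    ← single_neg]
  simp [hil.symm, hij.symm, hlj.symm]
  abel

theorem conj_transvection_mem_elemMultiples {B B' : Type*} [CommRing B] [CommRing B']
    (φ : B →+* B') {p q : Fin m} (hpq : p ≠ q) {x : B'} {d c b : B} (hd : φ d * x = φ c)
    {i j : Fin m} (hij : i ≠ j) (h : q ≠ i ∨ p ≠ j) (f : B) :
    transvection p q x * transvection i j (φ (d * b * f)) * transvection p q (-x) ∈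
      elemMultiples m φ b := by
  have hx : x * φ (d * b * f) = φ (b * (c * f)) := by
    simp only [map_mul, ← hd]
    ring
  by_cases hqi : q = i
  · subst hqi
    have hpj : p ≠ j := by simpa using h
    have : transvection p q x * transvection q j (φ (d * b * f)) * transvection p q (-x) =
        transvection p j (x * φ (d * b * f)) * transvection q j (φ (d * b * f)) := by
      simp only [transvection, mul_add, add_mul, mul_one, one_mul, single_mul_single_eq_ite,
        ← single_neg]
      simp [hpj.symm, hpq.symm, hij.symm]
      abel
    rw [this]
    exact mul_mem (transvection_mem_elemMultiples φ hpj hx)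
      (transvection_mem_elemMultiples φ (f := d * f) hij (by congr 1; ring))
  · by_cases hpj : p = j
    · subst hpj
      have : transvection p q x * transvection i p (φ (d * b * f)) * transvection p q (-x) =
          transvection i p (φ (d * b * f)) * transvection i q (-(φ (d * b * f) * x)) := by
        simp only [transvection, mul_add, add_mul, mul_one, one_mul, single_mul_single_eq_ite,
          ← single_neg]
        simp [hqi, hpq.symm, hij.symm]
        abel
      rw [this]
      exact mul_mem (transvection_mem_elemMultiples φ (f := d * f) hij (by congr 1; ring))
        (transvection_mem_elemMultiples φ (f := -(c * f)) (Ne.symm hqi)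
          (by rw [mul_comm, hx, mul_neg, map_neg]))
    · have : transvection p q x * transvection i j (φ (d * b * f)) * transvection p q (-x) =
          transvection i j (φ (d * b * f)) := by
        simp only [transvection, mul_add, add_mul, mul_one, one_mul, single_mul_single_eq_ite,
          ← single_neg]
        simp [hqi, hpq.symm, Ne.symm hpj]
        try abel
      rw [this]
      exact transvection_mem_elemMultiples φ (f := d * f) hij (by congr 1; ring)

theorem conj_mem_elemMultiples (hm : 3 ≤ m) {B B' : Type*} [CommRing B] [CommRing B']
    (φ : B →+* B') {p q : Fin m} (hpq : p ≠ q) {x : B'} {d c b : B} (hd : φ d * x = φ c)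
    {M : Matrix (Fin m) (Fin m) B'} (hM : M ∈ elemMultiples m φ ((d * b) * (d * b))) :
    transvection p q x * M * transvection p q (-x) ∈ elemMultiples m φ b := by
  have hinv : transvection p q (-x) * transvection p q x = 1 := by
    rw [transvection_mul_transvection_same p q hpq, neg_add_cancel, transvection_zero]
  have hinv' : transvection p q x * transvection p q (-x) = 1 := by
    rw [transvection_mul_transvection_same p q hpq, add_neg_cancel, transvection_zero]
  have hmul : ∀ Y Z : Matrix (Fin m) (Fin m) B',
      transvection p q x * Y * transvection p q (-x) ∈ elemMultiples m φ b →
      transvection p q x * Z * transvection p q (-x) ∈ elemMultiples m φ b →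
      transvection p q x * (Y * Z) * transvection p q (-x) ∈ elemMultiples m φ b := by
    intro Y Z hY hZ
    have := mul_mem hY hZ
    rwa [show transvection p q x * Y * transvection p q (-x) *
        (transvection p q x * Z * transvection p q (-x)) = transvection p q x * Y *
        (transvection p q (-x) * transvection p q x) * Z * transvection p q (-x) by
          simp only [mul_assoc], hinv, mul_one, mul_assoc (transvection p q x)] at this
  induction hM using Submonoid.closure_induction with
  | mem M hM =>
    obtain ⟨i, j, f, hij, rfl⟩ := hM
    by_cases h : q ≠ i ∨ p ≠ j
    · rw [show d * b * (d * b) * f = d * b * (d * b * f) by ring]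
      exact conj_transvection_mem_elemMultiples φ hpq hd hij h _
    · obtain ⟨rfl, rfl⟩ : q = i ∧ p = j := by simpa [not_or] using h
      obtain ⟨l, hlp, hlq⟩ : ∃ l : Fin m, l ≠ p ∧ l ≠ q := by
        obtain ⟨l, hl⟩ := Finset.exists_mem_notMem_of_card_lt_card
          (s := {p, q}) (t := (Finset.univ : Finset (Fin m)))
          (by rw [Finset.card_pair hpq, Finset.card_univ, Fintype.card_fin]; omega)
        exact ⟨l, by simpa [not_or] using hl.2⟩
      rw [mul_assoc (d * b), map_mul, ← transvection_mul_commutator hlq.symm hlp hij]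
      refine hmul _ _ (hmul _ _ (hmul _ _ ?_ ?_) ?_) ?_
      · simpa using conj_transvection_mem_elemMultiples φ (b := b) hpq hd hlq.symm
          (Or.inr hlp.symm) 1
      · exact conj_transvection_mem_elemMultiples φ hpq hd hlp (Or.inl hlq.symm) f
      · simpa using conj_transvection_mem_elemMultiples φ (b := b) hpq hd hlq.symm
          (Or.inr hlp.symm) (-1)
      · rw [← map_neg, ← mul_neg]
        exact conj_transvection_mem_elemMultiples φ hpq hd hlp (Or.inl hlq.symm) (-f)
  | one => rw [mul_one, hinv']; exact one_mem _
  | mul Y Z _ _ hY hZ => exact hmul _ _ hY hZ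

end Dilation

section LocalGlobal

open Polynomial

variable {m : ℕ}

/-- The substitution `X ↦ a X`. -/
noncomputable def scaleVar {R : Type*} [CommRing R] (a : R) : R[X] →+* R[X] :=
  eval₂RingHom C (C a * X)

/-- The substitution `X ↦ 0`. -/
noncomputable def evalZeroC (R : Type*) [CommRing R] : R[X] →+* R[X] :=
  C.comp (evalRingHom 0)

@[simp]
theorem scaleVar_C {R : Type*} [CommRing R] (a x : R) : scaleVar a (C x) = C x := by
  simp [scaleVar]

@[simp]
theorem scaleVar_X {R : Type*} [CommRing R] (a : R) : scaleVar a (X : R[X]) = C a * X := by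
  simp [scaleVar]

@[simp]
theorem evalZeroC_C {R : Type*} [CommRing R] (x : R) : evalZeroC R (C x) = C x := by
  simp [evalZeroC]

@[simp]
theorem evalZeroC_X {R : Type*} [CommRing R] : evalZeroC R (X : R[X]) = 0 := by
  simp [evalZeroC]

theorem scaleVar_comp {R : Type*} [CommRing R] (a b : R) :
    (scaleVar a).comp (scaleVar b) = scaleVar (a * b) := by
  apply Polynomial.ringHom_ext
  · intro x; simp
  · simp; ring

theorem mapRingHom_comp_scaleVar {R R' : Type*} [CommRing R] [CommRing R'] (φ : R →+* R') (a : R) :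
    (mapRingHom φ).comp (scaleVar a) = (scaleVar (φ a)).comp (mapRingHom φ) := by
  apply Polynomial.ringHom_ext
  · intro x; simp
  · simp

theorem mapRingHom_comp_evalZeroC {R R' : Type*} [CommRing R] [CommRing R'] (φ : R →+* R') :
    (mapRingHom φ).comp (evalZeroC R) = (evalZeroC R').comp (mapRingHom φ) := by
  apply Polynomial.ringHom_ext
  · intro x; simp
  · simp

theorem evalZeroC_comp_scaleVar {R : Type*} [CommRing R] (a : R) :
    (evalZeroC R).comp (scaleVar a) = evalZeroC R := by
  apply Polynomial.ringHom_ext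
  · intro x; simp
  · simp

theorem scaleVar_comp_evalZeroC {R : Type*} [CommRing R] (a : R) :
    (scaleVar a).comp (evalZeroC R) = evalZeroC R := by
  apply Polynomial.ringHom_ext
  · intro x; simp
  · simp

theorem evalZeroC_comp_evalZeroC {R : Type*} [CommRing R] :
    (evalZeroC R).comp (evalZeroC R) = evalZeroC R := by
  apply Polynomial.ringHom_ext
  · intro x; simp
  · simp

/-- The substitution `X ↦ X + Y`, with values in the polynomial ring in a further variable `Y`. -/
noncomputable def addVar (R : Type*) [CommRing R] : R[X] →+* R[X][X] :=
  eval₂RingHom ((C : R[X] →+* R[X][X]).comp C) (C X + X)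

@[simp]
theorem addVar_C {R : Type*} [CommRing R] (x : R) : addVar R (C x) = C (C x) := by
  simp [addVar]

@[simp]
theorem addVar_X {R : Type*} [CommRing R] : addVar R (X : R[X]) = C X + X := by
  simp [addVar]

theorem mapRingHom_comp_addVar {R R' : Type*} [CommRing R] [CommRing R'] (φ : R →+* R') :
    (mapRingHom (mapRingHom φ)).comp (addVar R) = (addVar R').comp (mapRingHom φ) := by
  apply Polynomial.ringHom_ext
  · intro x; simp
  · simp

theorem evalZeroC_comp_addVar {R : Type*} [CommRing R] :
    (evalZeroC R[X]).comp (addVar R) = C := by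
  apply Polynomial.ringHom_ext
  · intro x; simp
  · simp

theorem mapMatrix_mapMatrix {R R' R'' : Type*} [CommRing R] [CommRing R'] [CommRing R'']
    (ψ : R' →+* R'') (φ : R →+* R') (M : Matrix (Fin m) (Fin m) R) :
    ψ.mapMatrix (φ.mapMatrix M) = (ψ.comp φ).mapMatrix M := rfl

theorem scaleVar_mem_elemMultiples {R R' : Type*} [CommRing R] [CommRing R'] (φ : R →+* R')
    (a b : R) {M : Matrix (Fin m) (Fin m) R'[X]}
    (hM : M ∈ elemMultiples m (mapRingHom φ) (C b)) :
    (scaleVar (φ a)).mapMatrix M ∈ elemMultiples m (mapRingHom φ) (C b) := by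
  induction hM using Submonoid.closure_induction with
  | mem x hx =>
    obtain ⟨i, j, f, h, rfl⟩ := hx
    rw [mapMatrix_transvection]
    refine transvection_mem_elemMultiples _ h (f := scaleVar a f) ?_
    have := congrArg (fun ψ => ψ (C b * f)) (mapRingHom_comp_scaleVar φ a)
    simpa using this.symm
  | one => rw [map_one]; exact one_mem _
  | mul x y _ _ hx hy => rw [map_mul]; exact mul_mem hx hy

theorem exists_scaleVar_eq_mul (hm : 3 ≤ m) {R R' : Type*} [CommRing R] [CommRing R']
    {φ : R →+* R'} {S : Submonoid R} (h : IsFractionMap φ S)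
    {M : Matrix (Fin m) (Fin m) R'[X]} (hM : M ∈ elemMonoid m R'[X]) :
    ∀ b ∈ S, ∃ a ∈ S, ∃ N ∈ elemMultiples m (mapRingHom φ) (C b),
      (scaleVar (φ a)).mapMatrix M = N * (evalZeroC R').mapMatrix M := by
  induction hM using Submonoid.closure_induction_left with
  | one => exact fun b _ => ⟨1, one_mem _, 1, one_mem _, by simp⟩
  | mul_left e he M _ ih =>
    intro b hb
    obtain ⟨i, j, c, hij, rfl⟩ := he
    obtain ⟨d, hd, y, hdy⟩ := h.surj (c.coeff 0)
    obtain ⟨a, ha, N, hN, haN⟩ := ih ((d * b) * (d * b)) (mul_mem (mul_mem hd hb) (mul_mem hd hb))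
    obtain ⟨_, ⟨s, hs, rfl⟩, c', hc'⟩ := h.polynomial.surj c.divX
    refine ⟨(s * b) * a, mul_mem (mul_mem hs hb) ha,
      transvection i j (mapRingHom φ (C b * (C a * X * scaleVar ((s * b) * a) c'))) *
        (transvection i j (C (c.coeff 0)) * (scaleVar (φ (s * b))).mapMatrix N *
          transvection i j (-C (c.coeff 0))), ?_, ?_⟩
    · refine mul_mem (transvection_mem_elemMultiples _ hij rfl) ?_
      refine conj_mem_elemMultiples hm _ hij (d := C d) (c := C y) ?_ ?_
      · simp [← hdy]
      · rw [← map_mul, ← map_mul]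
        exact scaleVar_mem_elemMultiples φ _ _ hN
    · have h1 : scaleVar (φ ((s * b) * a)) c =
          mapRingHom φ (C b * (C a * X * scaleVar ((s * b) * a) c')) + C (c.coeff 0) := by
        have h2 := congrArg (fun ψ => ψ c') (mapRingHom_comp_scaleVar φ ((s * b) * a))
        simp only [RingHom.comp_apply] at h2
        rw [map_mul (mapRingHom φ), map_mul (mapRingHom φ), h2, ← hc']
        conv_lhs => rw [← divX_mul_X_add c]
        simp
        ring
      have h3 : (scaleVar (φ ((s * b) * a))).mapMatrix M =
          (scaleVar (φ (s * b))).mapMatrix N * (evalZeroC R').mapMatrix M := by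
        rw [map_mul φ, ← scaleVar_comp, ← mapMatrix_mapMatrix, haN, map_mul, mapMatrix_mapMatrix,
          scaleVar_comp_evalZeroC]
      have h4 : evalZeroC R' c = C (c.coeff 0) := by
        simp [evalZeroC, coeff_zero_eq_eval_zero]
      rw [map_mul (scaleVar (φ ((s * b) * a))).mapMatrix, map_mul (evalZeroC R').mapMatrix, h3,
        mapMatrix_transvection, mapMatrix_transvection, h1, h4,
        ← transvection_mul_transvection_same i j hij]
      simp only [mul_assoc]
      rw [← mul_assoc (transvection i j (-C (c.coeff 0))),
        transvection_mul_transvection_same i j hij, neg_add_cancel, transvection_zero, one_mul]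

theorem exists_scaleVar_eq_zero {R R' : Type*} [CommRing R] [CommRing R']
    {φ : R →+* R'} {S : Submonoid R} (h : IsFractionMap φ S) {p : R[X]}
    (hp : mapRingHom φ p = 0) (hp0 : p.coeff 0 = 0) :
    ∃ s ∈ S, ∀ u, scaleVar (u * s) p = 0 := by
  obtain ⟨_, ⟨s, hs, rfl⟩, hsp⟩ := h.polynomial.ker p hp
  refine ⟨s, hs, fun u => ?_⟩
  rw [← divX_mul_X_add p, hp0, map_zero, add_zero] at hsp ⊢
  rw [← mul_assoc] at hsp
  have h0 : C s * p.divX = 0 := by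
    simpa using hsp
  have := congrArg (scaleVar (u * s)) h0
  rw [map_mul, scaleVar_C, map_zero] at this
  rw [map_mul, scaleVar_X, map_mul C, show scaleVar (u * s) p.divX * (C u * C s * X) =
    C s * scaleVar (u * s) p.divX * (C u * X) by ring, this, zero_mul]

theorem exists_scaleVar_matrix_eq_zero {R R' : Type*} [CommRing R] [CommRing R']
    {φ : R →+* R'} {S : Submonoid R} (h : IsFractionMap φ S) {M : Matrix (Fin m) (Fin m) R[X]}
    (hM : (mapRingHom φ).mapMatrix M = 0) (hM0 : (evalZeroC R).mapMatrix M = 0) :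
    ∃ s ∈ S, (scaleVar s).mapMatrix M = 0 := by
  have H : ∀ F : Finset (Fin m × Fin m), ∃ s ∈ S, ∀ x ∈ F, ∀ u,
      scaleVar (u * s) (M x.1 x.2) = 0 := by
    intro F
    induction F using Finset.induction_on with
    | empty => exact ⟨1, one_mem _, by simp⟩
    | insert x F _ ih =>
      obtain ⟨s, hs, hF⟩ := ih
      obtain ⟨v, hv, hx⟩ := exists_scaleVar_eq_zero h (p := M x.1 x.2)
        (congrFun (congrFun hM x.1) x.2) (by
          have := congrFun (congrFun hM0 x.1) x.2
          simpa [evalZeroC, coeff_zero_eq_eval_zero] using this)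
      refine ⟨s * v, mul_mem hs hv, fun y hy u => ?_⟩
      rcases Finset.mem_insert.1 hy with rfl | hy
      · rw [← mul_assoc]
        exact hx _
      · rw [mul_comm s, ← mul_assoc]
        exact hF y hy _
  obtain ⟨s, hs, H⟩ := H Finset.univ
  refine ⟨s, hs, ?_⟩
  ext1 i j
  simpa using H (i, j) (Finset.mem_univ _) 1

theorem exists_scaleVar_mem_elemMonoid (hm : 3 ≤ m) {R R' : Type*} [CommRing R] [CommRing R']
    {φ : R →+* R'} {S : Submonoid R} (h : IsFractionMap φ S)
    {M : Matrix (Fin m) (Fin m) R[X]} (hM0 : (evalZeroC R).mapMatrix M = 1)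
    (hM : (mapRingHom φ).mapMatrix M ∈ elemMonoid m R'[X]) :
    ∃ a ∈ S, (scaleVar a).mapMatrix M ∈ elemMonoid m R[X] := by
  obtain ⟨a, ha, N, hN, haN⟩ := exists_scaleVar_eq_mul hm h hM 1 (one_mem _)
  obtain ⟨E, hE, rfl⟩ := exists_lift_of_mem_elemMultiples _ hN
  rw [mapMatrix_mapMatrix, mapMatrix_mapMatrix, ← mapRingHom_comp_evalZeroC,
    ← mapRingHom_comp_scaleVar, ← mapMatrix_mapMatrix, ← mapMatrix_mapMatrix, hM0, map_one,
    mul_one] at haN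
  obtain ⟨F, hF, hEF, -⟩ := exists_inverse_of_mem_elemMonoid
    (mapMatrix_mem_elemMonoid (evalZeroC R) hE)
  have hF0 : (evalZeroC R).mapMatrix E * (evalZeroC R).mapMatrix F = 1 := by
    have := congrArg (evalZeroC R).mapMatrix hEF
    rwa [map_mul, mapMatrix_mapMatrix, evalZeroC_comp_evalZeroC, map_one] at this
  have hF1 : (mapRingHom φ).mapMatrix F = 1 := by
    have h1 := congrArg (mapRingHom φ).mapMatrix hEF
    have h2 := congrArg (evalZeroC R').mapMatrix haN
    rw [mapMatrix_mapMatrix, mapMatrix_mapMatrix, mapMatrix_mapMatrix,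
      ← mapRingHom_comp_evalZeroC, RingHom.comp_assoc, evalZeroC_comp_scaleVar,
      ← mapMatrix_mapMatrix, hM0] at h2
    rw [map_mul, mapMatrix_mapMatrix, ← h2, map_one, one_mul] at h1
    exact h1
  obtain ⟨s, hs, H⟩ := exists_scaleVar_matrix_eq_zero h
    (M := (scaleVar a).mapMatrix M - E * F)
    (by rw [map_sub, map_mul, hF1, haN, mul_one, sub_self])
    (by rw [map_sub, map_mul, hF0, mapMatrix_mapMatrix, evalZeroC_comp_scaleVar, hM0, sub_self])
  refine ⟨s * a, mul_mem hs ha, ?_⟩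
  rw [map_sub, sub_eq_zero, mapMatrix_mapMatrix, scaleVar_comp] at H
  rw [H]
  exact mapMatrix_mem_elemMonoid _ (mul_mem hE hF)

/-- The local-global principle for elementary matrices over a polynomial ring. -/
theorem mem_elemMonoid_of_localization (hm : 3 ≤ m) {A : Type*} [CommRing A]
    {g g' : Matrix (Fin m) (Fin m) A[X]} (hg : g * g' = 1) (hg' : g' * g = 1)
    (hg0 : (evalZeroC A).mapMatrix g = 1)
    (h : ∀ p : Ideal A, ∀ [p.IsMaximal],
      (mapRingHom (algebraMap A (Localization.AtPrime p))).mapMatrix g ∈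
        elemMonoid m (Localization.AtPrime p)[X]) :
    g ∈ elemMonoid m A[X] := by
  let I : Ideal A :=
    { carrier := { a | ∀ x b, (scaleVar (b + a * x)).mapMatrix g * (scaleVar b).mapMatrix g' ∈
        elemMonoid m A[X] }
      zero_mem' := by
        intro x b
        rw [zero_mul, add_zero, ← map_mul, hg, map_one]
        exact one_mem _
      add_mem' := by
        intro a a' ha ha' x b
        have := mul_mem (ha' x (b + a * x)) (ha x b)
        rwa [mul_assoc, ← mul_assoc ((scaleVar (b + a * x)).mapMatrix g'), ← map_mul, hg', map_one,
          one_mul, add_assoc, ← add_mul] at this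
      smul_mem' := by
        intro c a ha x b
        have := ha (c * x) b
        rwa [← mul_assoc, mul_comm a] at this }
  have hI : I = ⊤ := by
    by_contra hI
    obtain ⟨p, hp, hIp⟩ := I.exists_le_maximal hI
    have hfrac := (IsFractionMap.of_isLocalization (R' := Localization.AtPrime p)
      p.primeCompl).polynomial
    have hC : (evalZeroC A[X]).comp C = C := RingHom.ext fun x => by simp
    obtain ⟨_, ⟨a, ha, rfl⟩, H⟩ := exists_scaleVar_mem_elemMonoid hm hfrac
      (M := (addVar A).mapMatrix g * (C : A[X] →+* A[X][X]).mapMatrix g')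
      (by rw [map_mul, mapMatrix_mapMatrix, mapMatrix_mapMatrix, evalZeroC_comp_addVar, hC,
        ← map_mul, hg, map_one])
      (by
        obtain ⟨G, hG, hG1, hG2⟩ := exists_inverse_of_mem_elemMonoid (h p)
        have hGg : G = (mapRingHom (algebraMap A (Localization.AtPrime p))).mapMatrix g' := by
          have h1 := congrArg (mapRingHom (algebraMap A (Localization.AtPrime p))).mapMatrix hg
          rw [map_mul, map_one] at h1
          calc G = G * (_ * _) := by rw [h1, mul_one]
            _ = _ := by rw [← mul_assoc, hG2, one_mul]
        have e1 := mapRingHom_comp_addVar (algebraMap A (Localization.AtPrime p))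
        have e2 : (mapRingHom (mapRingHom (algebraMap A (Localization.AtPrime p)))).comp C =
            C.comp (mapRingHom (algebraMap A (Localization.AtPrime p))) :=
          RingHom.ext fun x => by simp
        rw [map_mul, mapMatrix_mapMatrix, mapMatrix_mapMatrix, e1, e2, ← mapMatrix_mapMatrix,
          ← mapMatrix_mapMatrix, ← hGg]
        exact mul_mem (mapMatrix_mem_elemMonoid _ (h p)) (mapMatrix_mem_elemMonoid _ hG))
    refine ha (hIp ?_)
    intro x b
    let ε : A[X][X] →+* A[X] := eval₂RingHom (scaleVar b) (C x * X)
    have e1 : (ε.comp (scaleVar (C a))).comp (addVar A) = scaleVar (b + a * x) := by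
      apply Polynomial.ringHom_ext
      · intro x; simp [ε]
      · simp [ε]; ring
    have e2 : (ε.comp (scaleVar (C a))).comp C = scaleVar b := RingHom.ext fun x => by simp [ε]
    have := mapMatrix_mem_elemMonoid ε H
    rwa [mapMatrix_mapMatrix, map_mul, mapMatrix_mapMatrix, mapMatrix_mapMatrix, e1, e2] at this
  have h1 : (1 : A) ∈ I := hI ▸ Submodule.mem_top
  have h2 := h1 1 0
  have e1 : scaleVar (0 + 1 * 1 : A) = RingHom.id _ := by
    apply Polynomial.ringHom_ext
    · intro x; simp
    · simp
  have e2 : scaleVar (0 : A) = evalZeroC A := by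
    apply Polynomial.ringHom_ext
    · intro x; simp
    · simp
  have e3 : (evalZeroC A).mapMatrix g' = 1 := by
    have := congrArg (evalZeroC A).mapMatrix hg
    rwa [map_mul, hg0, map_one, one_mul] at this
  rwa [e1, e2, e3, mul_one] at h2

end LocalGlobal

section LaurentMatrices

open Polynomial

variable {m : ℕ}

/-- The embedding of polynomials into Laurent series in the inverse variable. -/
noncomputable def polyToLaurent (A : Type*) [CommRing A] : A[X] →+* LaurentSeries A :=
  eval₂RingHom (HahnSeries.C : A →+* LaurentSeries A) (HahnSeries.single (-1) 1)

/-- The embedding of power series into Laurent series. -/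
noncomputable abbrev powerToLaurent (A : Type*) [CommRing A] : PowerSeries A →+* LaurentSeries A :=
  HahnSeries.ofPowerSeries ℤ A

/-- The diagonal matrix whose entries are the powers of the inverse variable prescribed by `μ`. -/
noncomputable def diagPow (A : Type*) [CommRing A] (μ : Fin m → ℤ) :
    Matrix (Fin m) (Fin m) (LaurentSeries A) :=
  diagonal fun k => HahnSeries.single (-μ k) 1

/-- The diagonal matrix with the entry `X` at `i` and `1` elsewhere. -/
noncomputable def diagX (A : Type*) [CommRing A] (i : Fin m) :
    Matrix (Fin m) (Fin m) (PowerSeries A) :=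
  diagonal fun k => if k = i then PowerSeries.X else 1

variable {A : Type*} [CommRing A]

theorem single_pow_one (n : ℕ) (k : ℤ) :
    (HahnSeries.single k (1 : A)) ^ n = HahnSeries.single (n * k) 1 := by
  rw [HahnSeries.single_pow, one_pow, nsmul_eq_mul]

@[simp]
theorem polyToLaurent_C (a : A) : polyToLaurent A (C a) = HahnSeries.C a := by
  simp [polyToLaurent]

@[simp]
theorem polyToLaurent_X : polyToLaurent A X = HahnSeries.single (-1) 1 := by
  simp [polyToLaurent]

theorem polyToLaurent_C_mul_X_pow (a : A) (n : ℕ) :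
    polyToLaurent A (C a * X ^ n) = HahnSeries.single (-(n : ℤ)) a := by
  rw [map_mul, map_pow, polyToLaurent_C, polyToLaurent_X, single_pow_one, HahnSeries.C_apply,
    HahnSeries.single_mul_single]
  simp

theorem powerToLaurent_C_mul_X_pow (a : A) (n : ℕ) :
    powerToLaurent A (PowerSeries.C a * PowerSeries.X ^ n) = HahnSeries.single (n : ℤ) a := by
  rw [map_mul, HahnSeries.ofPowerSeries_C, HahnSeries.ofPowerSeries_X_pow,
    HahnSeries.C_apply, HahnSeries.single_mul_single]
  simp

theorem coeff_polyToLaurent (p : A[X]) (n : ℤ) :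
    (polyToLaurent A p).coeff n = if n ≤ 0 then p.coeff n.natAbs else 0 := by
  induction p using Polynomial.induction_on' with
  | add p q hp hq =>
    rw [map_add, HahnSeries.coeff_add, hp, hq, coeff_add]
    split_ifs <;> simp
  | monomial k a =>
    rw [← C_mul_X_pow_eq_monomial, polyToLaurent_C_mul_X_pow, HahnSeries.coeff_single,
      coeff_C_mul_X_pow]
    split_ifs <;> first | rfl | omega

theorem coeff_powerToLaurent_of_neg (f : PowerSeries A) {n : ℤ} (hn : n < 0) :
    (powerToLaurent A f).coeff n = 0 := by
  rw [HahnSeries.ofPowerSeries_apply]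
  apply HahnSeries.embDomain_of_notMem_range
  rintro ⟨k, rfl⟩
  exact absurd hn (by simp)

theorem eq_C_of_polyToLaurent_eq {p : A[X]} {f : PowerSeries A}
    (h : polyToLaurent A p = powerToLaurent A f) : p = C (p.coeff 0) := by
  ext n
  rw [coeff_C]
  split_ifs with hn
  · rw [hn]
  · have := congrArg (fun x => HahnSeries.coeff x (-(n : ℤ))) h
    simp only [coeff_polyToLaurent] at this
    rw [coeff_powerToLaurent_of_neg _ (by omega)] at this
    simpa using this

theorem eq_zero_of_polyToLaurent_eq {p : A[X]} {f : PowerSeries A} {k : ℤ} (hk : 0 < k)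
    (h : polyToLaurent A p = HahnSeries.single k 1 * powerToLaurent A f) : p = 0 := by
  ext n
  have := congrArg (fun x => HahnSeries.coeff x (-(n : ℤ))) h
  simp only [coeff_polyToLaurent] at this
  rw [HahnSeries.coeff_single_mul, coeff_powerToLaurent_of_neg _ (by omega)] at this
  simpa using this

theorem diagPow_add (μ ν : Fin m → ℤ) : diagPow A (μ + ν) = diagPow A μ * diagPow A ν := by
  rw [diagPow, diagPow, diagPow, diagonal_mul_diagonal]
  congr 1
  ext1 k
  rw [HahnSeries.single_mul_single, Pi.add_apply, neg_add, one_mul]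

@[simp]
theorem diagPow_zero : diagPow A (0 : Fin m → ℤ) = 1 := by
  rw [diagPow, ← diagonal_one]
  simp

theorem diagPow_mul_apply (μ : Fin m → ℤ) (M : Matrix (Fin m) (Fin m) (LaurentSeries A))
    (a b : Fin m) : (diagPow A μ * M) a b = HahnSeries.single (-μ a) 1 * M a b := by
  rw [diagPow, diagonal_mul]

theorem mul_diagPow_apply (μ : Fin m → ℤ) (M : Matrix (Fin m) (Fin m) (LaurentSeries A))
    (a b : Fin m) : (M * diagPow A μ) a b = M a b * HahnSeries.single (-μ b) 1 := by
  rw [diagPow, mul_diagonal]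

theorem diagPow_transpose (μ : Fin m → ℤ) : (diagPow A μ)ᵀ = diagPow A μ := diagonal_transpose _

theorem powerToLaurent_diagX (i : Fin m) :
    (powerToLaurent A).mapMatrix (diagX A i) = diagPow A (-Pi.single i 1) := by
  ext1 a b
  rw [RingHom.mapMatrix_apply, Matrix.map_apply, diagX, diagPow, diagonal_apply, diagonal_apply]
  by_cases hab : a = b
  · by_cases hai : a = i
    · subst hab hai
      simp [HahnSeries.ofPowerSeries_X]
    · rw [if_pos hab, if_pos hab, if_neg hai, Pi.neg_apply, Pi.single_eq_of_ne hai]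
      simp
  · simp [hab]

theorem diagX_mul_apply (i : Fin m) (M : Matrix (Fin m) (Fin m) (PowerSeries A)) (a b : Fin m) :
    (diagX A i * M) a b = (if a = i then PowerSeries.X else 1) * M a b := by
  rw [diagX, diagonal_mul]

theorem mul_diagX_apply (i : Fin m) (M : Matrix (Fin m) (Fin m) (PowerSeries A)) (a b : Fin m) :
    (M * diagX A i) a b = M a b * (if b = i then PowerSeries.X else 1) := by
  rw [diagX, mul_diagonal]

theorem det_diagX (i : Fin m) : (diagX A i).det = PowerSeries.X := by
  rw [diagX, det_diagonal]
  simp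

theorem map_diagX {κ : Type*} [CommRing κ] (φ : A →+* κ) (i : Fin m) :
    (PowerSeries.map φ).mapMatrix (diagX A i) = diagX κ i := by
  ext1 a b
  rw [RingHom.mapMatrix_apply, Matrix.map_apply, diagX, diagX, diagonal_apply, diagonal_apply]
  split_ifs <;> simp

theorem mul_diagX_injective (i : Fin m) :
    Function.Injective fun M : Matrix (Fin m) (Fin m) (PowerSeries A) => M * diagX A i := by
  intro M N h
  ext1 a b
  have := congrFun (congrFun h a) b
  simp only [mul_diagX_apply] at this
  split_ifs at this
  · exact PowerSeries.X_mul_cancel (by rwa [mul_comm _ PowerSeries.X, mul_comm _ PowerSeries.X]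
      at this)
  · simpa using this

/-- Multiplying the row `i` by `X` and dividing the column `j` by `X` is possible when
the column `j` vanishes outside `i` at the origin. -/
theorem exists_diagX_mul_eq (i j : Fin m) (M : Matrix (Fin m) (Fin m) (PowerSeries A))
    (hM : ∀ a, a ≠ i → PowerSeries.constantCoeff (M a j) = 0) :
    ∃ N, diagX A i * M = N * diagX A j ∧ N.det = M.det := by
  have H : ∀ a b, ∃ y, (if a = i then PowerSeries.X else 1) * M a b =
      y * (if b = j then PowerSeries.X else 1) := by
    intro a b
    by_cases hb : b = j
    · subst hb
      by_cases ha : a = i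
      · exact ⟨M a b, by simp [ha, mul_comm]⟩
      · obtain ⟨y, hy⟩ := PowerSeries.X_dvd_iff.2 (hM a ha)
        exact ⟨y, by simp [ha, hy, mul_comm]⟩
    · exact ⟨_, by rw [if_neg hb, mul_one]⟩
  choose N hN using H
  have h : diagX A i * M = of N * diagX A j := by
    ext1 a b
    rw [diagX_mul_apply, mul_diagX_apply]
    exact hN a b
  refine ⟨of N, h, ?_⟩
  have := congrArg det h
  rw [det_mul, det_mul, det_diagX, det_diagX, mul_comm (of N).det] at this
  exact (PowerSeries.X_mul_cancel this).symm

theorem mapMatrix_eq_one_of_diagX_mul_eq {κ : Type*} [CommRing κ] (φ : A →+* κ) {i : Fin m}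
    {M N : Matrix (Fin m) (Fin m) (PowerSeries A)} (h : diagX A i * M = N * diagX A i)
    (hM : (PowerSeries.map φ).mapMatrix M = 1) : (PowerSeries.map φ).mapMatrix N = 1 := by
  have := congrArg (PowerSeries.map φ).mapMatrix h
  rw [map_mul, map_mul, hM, map_diagX, mul_one] at this
  exact mul_diagX_injective i (by simpa using this.symm)

theorem exists_mul_diagX_eq (i : Fin m) (M : Matrix (Fin m) (Fin m) (PowerSeries A))
    (hM : ∀ b, b ≠ i → PowerSeries.constantCoeff (M i b) = 0) :
    ∃ N, M * diagX A i = diagX A i * N := by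
  obtain ⟨N, hN, -⟩ := exists_diagX_mul_eq i i Mᵀ hM
  refine ⟨Nᵀ, ?_⟩
  have := congrArg transpose hN
  simpa [transpose_mul, diagX] using this

end LaurentMatrices

section Swap

open Polynomial

variable {m : ℕ} {A κ : Type*} [CommRing A] [Field κ] (φ : A →+* κ)

theorem isUnit_of_map_eq_one [IsLocalHom φ] {a : A} (h : φ a = 1) : IsUnit a :=
  isUnit_of_map_unit φ a (h ▸ isUnit_one)

theorem constantCoeff_powerSeries_map (f : PowerSeries A) :
    PowerSeries.constantCoeff (PowerSeries.map φ f) = φ (PowerSeries.constantCoeff f) := by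
  rw [← PowerSeries.coeff_zero_eq_constantCoeff_apply, PowerSeries.coeff_map,
    PowerSeries.coeff_zero_eq_constantCoeff_apply]

theorem map_colMatrix {S S' : Type*} [CommRing S] [CommRing S'] (ψ : S →+* S') (i : Fin m)
    (w : Fin m → S) : ψ.mapMatrix (colMatrix i w) = colMatrix i fun a => ψ (w a) := by
  ext1 a b
  rw [RingHom.mapMatrix_apply, Matrix.map_apply, colMatrix_apply, colMatrix_apply, map_add,
    Matrix.one_apply, Matrix.one_apply]
  split_ifs <;> simp

theorem colMatrix_zero {S : Type*} [CommRing S] (i : Fin m) :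
    colMatrix i (0 : Fin m → S) = 1 := by
  simp [colMatrix]

theorem colMatrix_mul_apply {S : Type*} [CommRing S] (i : Fin m) (w : Fin m → S)
    (M : Matrix (Fin m) (Fin m) S) (a b : Fin m) :
    (colMatrix i w * M) a b = M a b + w a * M i b := by
  rw [colMatrix, add_mul, one_mul, Matrix.add_apply, vecMulVec_mul, vecMulVec_apply,
    single_one_vecMul]
  rfl

/-- Column operations with constant coefficients clearing the column `j` at the origin. -/
theorem exists_colMatrix_clear (i j : Fin m) (M : Matrix (Fin m) (Fin m) (PowerSeries A))
    (hM : IsUnit (PowerSeries.constantCoeff (M i j))) :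
    ∃ w : Fin m → A, w i = 0 ∧
      (∀ a, φ (PowerSeries.constantCoeff (M a j)) = 0 → φ (w a) = 0) ∧
      ∀ a, a ≠ i → PowerSeries.constantCoeff
        ((colMatrix i (fun a => PowerSeries.C (-w a)) * M) a j) = 0 := by
  obtain ⟨u, hu⟩ := hM.exists_left_inv
  refine ⟨fun a => if a = i then 0 else u * PowerSeries.constantCoeff (M a j), by simp, ?_, ?_⟩
  · intro a ha
    dsimp only
    split_ifs <;> simp [ha]
  · intro a ha
    rw [colMatrix_mul_apply, map_add, map_mul, PowerSeries.constantCoeff_C]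
    simp only [if_neg ha]
    linear_combination (-PowerSeries.constantCoeff (M a j)) * hu

/-- Row operations with constant coefficients clearing the row `i` at the origin. -/
theorem exists_rowMatrix_clear [IsLocalHom φ] (i : Fin m)
    (M : Matrix (Fin m) (Fin m) (PowerSeries A))
    (hM : (PowerSeries.map φ).mapMatrix M = 1) :
    ∃ w : Fin m → A, w i = 0 ∧ (∀ a, φ (w a) = 0) ∧
      ∀ b, b ≠ i → PowerSeries.constantCoeff
        (((colMatrix i (fun a => PowerSeries.C (-w a)))ᵀ * M) i b) = 0 := by
  set M0 : Matrix (Fin m) (Fin m) A := PowerSeries.constantCoeff.mapMatrix M with hM0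
  have hφ : φ.mapMatrix M0 = 1 := by
    have := congrArg (PowerSeries.constantCoeff (R := κ)).mapMatrix hM
    rw [map_one] at this
    rw [← this]
    ext1 a b
    simp [hM0, constantCoeff_powerSeries_map]
  have hadj : φ.mapMatrix M0.adjugate = 1 := by
    rw [RingHom.map_adjugate, hφ, adjugate_one]
  have hadj' : ∀ a, φ (M0.adjugate i a) = (1 : Matrix (Fin m) (Fin m) κ) i a := fun a =>
    congrFun (congrFun hadj i) a
  obtain ⟨u, hu⟩ := (isUnit_of_map_eq_one φ (by rw [hadj' i, Matrix.one_apply_eq])).exists_left_inv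
  refine ⟨fun a => if a = i then 0 else -(u * M0.adjugate i a), by simp, ?_, ?_⟩
  · intro a
    dsimp only
    split_ifs with ha
    · simp
    · rw [map_neg, map_mul, hadj' a, Matrix.one_apply_ne (Ne.symm ha)]
      simp
  · intro b hb
    have h1 : (M0.adjugate * M0) i b = 0 := by
      rw [adjugate_mul, Matrix.smul_apply, Matrix.one_apply_ne (Ne.symm hb), smul_zero]
    have h2 : PowerSeries.constantCoeff
        (((colMatrix i (fun a => PowerSeries.C
          (-(if a = i then 0 else -(u * M0.adjugate i a)))))ᵀ * M) i b) =
        u * (M0.adjugate * M0) i b := by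
      rw [Matrix.mul_apply, Matrix.mul_apply, map_sum, Finset.mul_sum]
      refine Finset.sum_congr rfl fun a _ => ?_
      rw [map_mul, transpose_apply, colMatrix_apply, if_pos rfl, map_add,
        PowerSeries.constantCoeff_C, ← mul_assoc]
      congr 1
      by_cases ha : a = i
      · subst ha
        simp [hu]
      · simp [ha]
    rw [h2, h1, mul_zero]

/-- The matrices `p` over `A[X]` which can be moved past the matrices over power series in the
inverse variable that are congruent to the identity modulo the maximal ideal. -/
def IsSwappable (p : Matrix (Fin m) (Fin m) A[X]) : Prop :=
  ∀ q : Matrix (Fin m) (Fin m) (PowerSeries A), (PowerSeries.map φ).mapMatrix q = 1 →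
    ∃ p' ∈ elemMonoid m A[X], ∃ q' : Matrix (Fin m) (Fin m) (PowerSeries A),
      (PowerSeries.map φ).mapMatrix q' = 1 ∧
      (powerToLaurent A).mapMatrix q * (polyToLaurent A).mapMatrix p =
        (polyToLaurent A).mapMatrix p' * (powerToLaurent A).mapMatrix q'

variable {φ}

theorem IsSwappable.mul {p p' : Matrix (Fin m) (Fin m) A[X]} (h : IsSwappable φ p)
    (h' : IsSwappable φ p') : IsSwappable φ (p * p') := by
  intro q hq
  obtain ⟨p1, hp1, q1, hq1, e1⟩ := h q hq
  obtain ⟨p2, hp2, q2, hq2, e2⟩ := h' q1 hq1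
  refine ⟨p1 * p2, mul_mem hp1 hp2, q2, hq2, ?_⟩
  rw [map_mul, ← mul_assoc, e1, mul_assoc, e2, map_mul, mul_assoc]

theorem isSwappable_transvection_C {i j : Fin m} (hij : i ≠ j) (a : A) :
    IsSwappable φ (transvection i j (C a)) := by
  intro q hq
  refine ⟨_, transvection_mem_elemMonoid hij (C a), transvection i j (PowerSeries.C (-a)) * q *
    transvection i j (PowerSeries.C a), ?_, ?_⟩
  · rw [map_mul, map_mul, hq, mul_one, ← map_mul, transvection_mul_transvection_same i j hij]
    simp
  · rw [map_mul, map_mul, mapMatrix_transvection, mapMatrix_transvection, mapMatrix_transvection,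
      polyToLaurent_C, HahnSeries.ofPowerSeries_C, HahnSeries.ofPowerSeries_C, ← mul_assoc,
      ← mul_assoc, transvection_mul_transvection_same i j hij, ← map_add]
    simp

theorem mul_eq_mul_of_conj {M : Type*} [Monoid M] {D D' V V' Q P E E' EX W W₀ WX R : M}
    (hD : D * D' = 1) (hV : V * V' = 1) (hE : E * E' = 1) (hW : W₀ * W = 1)
    (h1 : D' * (V' * Q) = P * D') (h2 : W * (E' * P * E) * D' = D' * R)
    (h3 : D' * EX = E * D') (h4 : D' * WX = W₀ * D') : Q * EX = V * EX * WX * R :=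
  calc Q * EX = V * (D * (D' * (V' * Q))) * EX := by
        rw [← mul_assoc D, hD, one_mul, ← mul_assoc V, hV, one_mul]
    _ = V * D * P * (D' * EX) := by rw [h1]; simp only [mul_assoc]
    _ = V * D * (E * E') * P * (E * D') := by rw [h3, hE, mul_one]
    _ = V * D * E * (W₀ * W) * (E' * P * E) * D' := by rw [hW, mul_one]; simp only [mul_assoc]
    _ = V * D * E * W₀ * (W * (E' * P * E) * D') := by simp only [mul_assoc]
    _ = V * D * E * (W₀ * D') * R := by rw [h2]; simp only [mul_assoc]
    _ = V * D * (E * D') * WX * R := by rw [← h4]; simp only [mul_assoc]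
    _ = V * (D * D') * EX * WX * R := by rw [← h3]; simp only [mul_assoc]
    _ = V * EX * WX * R := by rw [hD, mul_one]

theorem mapMatrix_transpose {S S' : Type*} [CommRing S] [CommRing S'] (ψ : S →+* S')
    (M : Matrix (Fin m) (Fin m) S) : ψ.mapMatrix Mᵀ = (ψ.mapMatrix M)ᵀ := rfl

theorem mapMatrix_eq_one_of_mul_diagX_eq {i : Fin m}
    {M N : Matrix (Fin m) (Fin m) (PowerSeries A)} (h : M * diagX A i = diagX A i * N)
    (hM : (PowerSeries.map φ).mapMatrix M = 1) : (PowerSeries.map φ).mapMatrix N = 1 := by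
  rw [← transpose_inj, ← mapMatrix_transpose, transpose_one]
  refine mapMatrix_eq_one_of_diagX_mul_eq φ (i := i) (M := Mᵀ) ?_ ?_
  · have := congrArg transpose h
    simpa [transpose_mul, diagX] using this
  · rw [mapMatrix_transpose, hM, transpose_one]

theorem diagPow_mul_colMatrix {μ : Fin m → ℤ} {i : Fin m} {w w' : Fin m → LaurentSeries A}
    (h : ∀ a, HahnSeries.single (-μ a) 1 * w a = w' a * HahnSeries.single (-μ i) 1) :
    diagPow A μ * colMatrix i w = colMatrix i w' * diagPow A μ := by
  ext1 a b
  rw [diagPow_mul_apply, mul_diagPow_apply, colMatrix_apply, colMatrix_apply, mul_add, add_mul]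
  congr 1
  · by_cases hab : a = b
    · rw [hab, mul_comm]
    · rw [Matrix.one_apply_ne hab, mul_zero, zero_mul]
  · split_ifs with hb
    · rw [hb, h]
    · rw [mul_zero, zero_mul]

theorem isSwappable_transvection_C_mul_X [IsLocalHom φ] {i j : Fin m} (hij : i ≠ j) (a : A) :
    IsSwappable φ (transvection i j (C a * X)) := by
  intro q hq
  have hunit : IsUnit (PowerSeries.constantCoeff (q i i)) := by
    refine isUnit_of_map_eq_one φ ?_
    have := congrArg (PowerSeries.constantCoeff (R := κ)) (congrFun (congrFun hq i) i)
    simpa [constantCoeff_powerSeries_map] using this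
  have hq0 : ∀ b, b ≠ i → φ (PowerSeries.constantCoeff (q b i)) = 0 := by
    intro b hb
    have := congrArg (PowerSeries.constantCoeff (R := κ)) (congrFun (congrFun hq b) i)
    simpa [Matrix.one_apply_ne hb, constantCoeff_powerSeries_map] using this
  obtain ⟨v, hvi, hv, hvq⟩ := exists_colMatrix_clear φ i i q hunit
  obtain ⟨q2, hq2, -⟩ := exists_diagX_mul_eq i i _ hvq
  have hv0 : ∀ b, φ (v b) = 0 := fun b => by
    by_cases hb : b = i
    · rw [hb, hvi, map_zero]
    · exact hv b (hq0 b hb)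
  have hq2' : (PowerSeries.map φ).mapMatrix q2 = 1 := by
    refine mapMatrix_eq_one_of_diagX_mul_eq φ hq2 ?_
    rw [map_mul, hq, mul_one, map_colMatrix, ← colMatrix_zero i]
    congr 1
    ext1 b
    simp [hv0]
  have hq3 : (PowerSeries.map φ).mapMatrix (transvection i j (PowerSeries.C (-a)) * q2 *
      transvection i j (PowerSeries.C a)) = 1 := by
    rw [map_mul, map_mul, hq2', mul_one, ← map_mul, transvection_mul_transvection_same i j hij]
    simp
  obtain ⟨w, hwi, hw, hwq⟩ := exists_rowMatrix_clear φ i _ hq3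
  obtain ⟨q5, hq5⟩ := exists_mul_diagX_eq i _ hwq
  have hq5' : (PowerSeries.map φ).mapMatrix q5 = 1 := by
    refine mapMatrix_eq_one_of_mul_diagX_eq hq5 ?_
    rw [map_mul, hq3, mul_one, mapMatrix_transpose, map_colMatrix, ← transpose_one,
      ← colMatrix_zero i]
    congr 2
    ext1 b
    simp [hw]
  refine ⟨colMatrix i (fun b => C (v b)) * transvection i j (C a * X) *
    (colMatrix i (fun b => C (w b) * X))ᵀ, ?_, q5, hq5', ?_⟩
  · refine mul_mem (mul_mem (colMatrix_mem_elemMonoid i _ ?_) (transvection_mem_elemMonoid hij _))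
      (transpose_mem_elemMonoid (colMatrix_mem_elemMonoid i _ ?_))
    · simp [hvi]
    · simp [hwi]
  · rw [map_mul, map_mul]
    refine mul_eq_mul_of_conj (D := diagPow A (Pi.single i 1)) (D' := diagPow A (-Pi.single i 1))
      (V' := (powerToLaurent A).mapMatrix (colMatrix i fun b => PowerSeries.C (-v b)))
      (E := (powerToLaurent A).mapMatrix (transvection i j (PowerSeries.C a)))
      (E' := (powerToLaurent A).mapMatrix (transvection i j (PowerSeries.C (-a))))
      (W := (powerToLaurent A).mapMatrix (colMatrix i fun b => PowerSeries.C (-w b))ᵀ)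
      (W₀ := (powerToLaurent A).mapMatrix (colMatrix i fun b => PowerSeries.C (w b))ᵀ)
      (P := (powerToLaurent A).mapMatrix q2) ?_ ?_ ?_ ?_ ?_ ?_ ?_ ?_
    · rw [← diagPow_add, add_neg_cancel, diagPow_zero]
    · rw [map_colMatrix, map_colMatrix, colMatrix_mul_colMatrix i _ _ (by simp [hvi]),
        ← colMatrix_zero i]
      congr 1
      ext1 b
      simp [HahnSeries.ofPowerSeries_C]
    · rw [← map_mul, transvection_mul_transvection_same i j hij]
      simp
    · rw [← map_mul, ← transpose_mul, colMatrix_mul_colMatrix i _ _ (by simp [hwi]),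
        ← map_one (powerToLaurent A).mapMatrix, ← transpose_one, ← colMatrix_zero i]
      congr 3
      ext1 b
      simp
    · rw [← powerToLaurent_diagX, ← map_mul, ← map_mul, hq2, map_mul]
    · rw [← powerToLaurent_diagX, ← map_mul, ← map_mul, ← map_mul, ← map_mul, hq5, map_mul]
    · rw [mapMatrix_transvection, mapMatrix_transvection, transvection_eq_colMatrix,
        transvection_eq_colMatrix]
      refine diagPow_mul_colMatrix fun b => ?_
      by_cases hb : b = i
      · subst hb
        simp [hij.symm, HahnSeries.ofPowerSeries_C, HahnSeries.C_apply]
      · simp [hb]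
    · rw [← transpose_inj, transpose_mul, transpose_mul, diagPow_transpose, mapMatrix_transpose,
        mapMatrix_transpose, transpose_transpose, transpose_transpose, map_colMatrix,
        map_colMatrix]
      refine (diagPow_mul_colMatrix fun b => ?_).symm
      by_cases hb : b = i
      · subst hb
        simp [hwi]
      · simp [hb, HahnSeries.ofPowerSeries_C, HahnSeries.C_apply]

theorem isSwappable_transvection [IsLocalHom φ] (hm : 3 ≤ m) (p : A[X]) :
    ∀ {i j : Fin m}, i ≠ j → IsSwappable φ (transvection i j p) := by
  have H : ∀ (n : ℕ) (a : A) (i j : Fin m), i ≠ j →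
      IsSwappable φ (transvection i j (C a * X ^ n)) := by
    intro n
    induction n with
    | zero =>
      intro a i j hij
      rw [pow_zero, mul_one]
      exact isSwappable_transvection_C hij a
    | succ n ih =>
      intro a i j hij
      obtain ⟨l, hl⟩ := Finset.exists_mem_notMem_of_card_lt_card
        (s := {i, j}) (t := (Finset.univ : Finset (Fin m)))
        (by rw [Finset.card_pair hij, Finset.card_univ, Fintype.card_fin]; omega)
      obtain ⟨hli, hlj⟩ : l ≠ i ∧ l ≠ j := by simpa [not_or] using hl.2
      rw [show C a * X ^ (n + 1) = (C 1 * X) * (C a * X ^ n) by rw [map_one]; ring,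
        ← transvection_mul_commutator hli.symm hlj hij, ← neg_mul, ← neg_mul, ← map_neg, ← map_neg]
      exact (((isSwappable_transvection_C_mul_X hli.symm _).mul (ih _ _ _ hlj)).mul
        (isSwappable_transvection_C_mul_X hli.symm _)).mul (ih _ _ _ hlj)
  induction p using Polynomial.induction_on' with
  | add p q hp hq =>
    intro i j hij
    rw [← transvection_mul_transvection_same i j hij]
    exact (hp hij).mul (hq hij)
  | monomial n a =>
    intro i j hij
    rw [← C_mul_X_pow_eq_monomial]
    exact H n a i j hij

theorem isSwappable_of_mem_elemMonoid [IsLocalHom φ] (hm : 3 ≤ m)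
    {p : Matrix (Fin m) (Fin m) A[X]} (hp : p ∈ elemMonoid m A[X]) : IsSwappable φ p := by
  induction hp using Submonoid.closure_induction with
  | mem x hx =>
    obtain ⟨i, j, a, h, rfl⟩ := hx
    exact isSwappable_transvection hm a h
  | one => exact fun q hq => ⟨1, one_mem _, q, hq, by rw [map_one, one_mul, mul_one]⟩
  | mul x y _ _ hx hy => exact hx.mul hy

end Swap

section Factorization

open Polynomial

variable {m : ℕ} {A κ : Type*} [CommRing A] [Field κ] {φ : A →+* κ}

/-- The matrices over Laurent series which factor as a product of an elementary matrix over
polynomials, a matrix over power series that is trivial modulo the maximal ideal, a diagonal matrix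
of monomials, and an invertible matrix over power series. -/
def HasFactorization (φ : A →+* κ) (x : Matrix (Fin m) (Fin m) (LaurentSeries A)) : Prop :=
  ∃ p ∈ elemMonoid m A[X], ∃ q : Matrix (Fin m) (Fin m) (PowerSeries A),
    (PowerSeries.map φ).mapMatrix q = 1 ∧ ∃ μ : Fin m → ℤ,
    ∃ k : Matrix (Fin m) (Fin m) (PowerSeries A), IsUnit k.det ∧
      x = (polyToLaurent A).mapMatrix p * (powerToLaurent A).mapMatrix q * diagPow A μ *
        (powerToLaurent A).mapMatrix k

theorem hasFactorization_one : HasFactorization φ (1 : Matrix (Fin m) (Fin m) (LaurentSeries A)) :=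
  ⟨1, one_mem _, 1, map_one _, 0, 1, by simp, by simp⟩

theorem HasFactorization.mul_powerToLaurent {x : Matrix (Fin m) (Fin m) (LaurentSeries A)}
    (hx : HasFactorization φ x) {k : Matrix (Fin m) (Fin m) (PowerSeries A)} (hk : IsUnit k.det) :
    HasFactorization φ (x * (powerToLaurent A).mapMatrix k) := by
  obtain ⟨p, hp, q, hq, μ, l, hl, rfl⟩ := hx
  refine ⟨p, hp, q, hq, μ, l * k, by rw [det_mul]; exact hl.mul hk, ?_⟩
  rw [map_mul]
  simp only [mul_assoc]

theorem diagPow_const_mul (n : ℤ) (M : Matrix (Fin m) (Fin m) (LaurentSeries A)) :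
    diagPow A (fun _ => n) * M = M * diagPow A (fun _ => n) := by
  ext1 a b
  rw [diagPow_mul_apply, mul_diagPow_apply, mul_comm]

theorem HasFactorization.mul_diagPow_const {x : Matrix (Fin m) (Fin m) (LaurentSeries A)}
    (hx : HasFactorization φ x) (n : ℤ) : HasFactorization φ (x * diagPow A fun _ => n) := by
  obtain ⟨p, hp, q, hq, μ, l, hl, rfl⟩ := hx
  refine ⟨p, hp, q, hq, μ + fun _ => n, l, hl, ?_⟩
  rw [diagPow_add, mul_assoc _ _ (diagPow A fun _ => n), ← diagPow_const_mul]
  simp only [mul_assoc]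

theorem exists_diagPow_mul_colMatrix (μ : Fin m → ℤ) {i : Fin m} {y : Fin m → A} (hyi : y i = 0)
    (hy : ∀ a, μ a < μ i → φ (y a) = 0) :
    ∃ p ∈ elemMonoid m A[X], ∃ q : Matrix (Fin m) (Fin m) (PowerSeries A),
      (PowerSeries.map φ).mapMatrix q = 1 ∧
      diagPow A μ * (powerToLaurent A).mapMatrix (colMatrix i fun a => PowerSeries.C (y a)) =
        (polyToLaurent A).mapMatrix p * (powerToLaurent A).mapMatrix q * diagPow A μ := by
  refine ⟨colMatrix i fun a => if μ i ≤ μ a then C (y a) * X ^ (μ a - μ i).toNat else 0,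
    colMatrix_mem_elemMonoid i _ (by simp [hyi]),
    colMatrix i fun a => if μ i ≤ μ a then 0 else
      PowerSeries.C (y a) * PowerSeries.X ^ (μ i - μ a).toNat, ?_, ?_⟩
  · rw [map_colMatrix, ← colMatrix_zero i]
    congr 1
    ext1 a
    split_ifs with h
    · simp
    · simp [hy a (not_le.1 h)]
  · rw [map_colMatrix, map_colMatrix, map_colMatrix, colMatrix_mul_colMatrix i _ _ (by simp)]
    refine diagPow_mul_colMatrix fun a => ?_
    rw [Pi.add_apply, HahnSeries.ofPowerSeries_C, HahnSeries.C_apply]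
    split_ifs with h
    · rw [polyToLaurent_C_mul_X_pow, map_zero, add_zero (HahnSeries.single _ _),
        HahnSeries.single_mul_single, HahnSeries.single_mul_single]
      congr 1
      · congr 1; omega
      · simp
    · rw [powerToLaurent_C_mul_X_pow, map_zero, zero_add (HahnSeries.single _ _),
        HahnSeries.single_mul_single, HahnSeries.single_mul_single]
      congr 1
      · congr 1; omega
      · simp

theorem mul_eq_mul_of_factor {M : Type*} [Monoid M] {D D' F F' V V' K L T P P₂ P₃ Q Q₂ Q₃ : M}
    (hD : D * D' = 1) (hF : F' * F = 1) (hV : V * V' = 1) (h1 : D' * (V' * K) = L * F')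
    (h2 : T * V = P₂ * Q₂ * T) (h3 : Q * P₂ = P₃ * Q₃) :
    P * Q * T * K * F = P * P₃ * (Q₃ * Q₂) * (T * D) * L :=
  calc P * Q * T * K * F = P * Q * T * (V * V') * K * F := by rw [hV, mul_one]
    _ = P * Q * (T * V) * (D * D') * V' * K * F := by rw [hD, mul_one]; simp only [mul_assoc]
    _ = P * Q * (P₂ * Q₂ * T) * D * (D' * (V' * K)) * F := by rw [h2]; simp only [mul_assoc]
    _ = P * (Q * P₂) * Q₂ * T * D * L * (F' * F) := by rw [h1]; simp only [mul_assoc]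
    _ = P * P₃ * (Q₃ * Q₂) * (T * D) * L := by rw [h3, hF, mul_one]; simp only [mul_assoc]

theorem HasFactorization.mul_diagPow_single [IsLocalHom φ] (hm : 3 ≤ m)
    {x : Matrix (Fin m) (Fin m) (LaurentSeries A)}
    (hx : HasFactorization φ x) (j : Fin m) :
    HasFactorization φ (x * diagPow A (Pi.single j 1)) := by
  obtain ⟨p, hp, q, hq, μ, k, hk, rfl⟩ := hx
  have hex : ∃ i, IsUnit (PowerSeries.constantCoeff (k i j)) := by
    by_contra! h
    have h0 : ∀ i, φ (PowerSeries.constantCoeff (k i j)) = 0 := fun i => by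
      by_contra h1
      exact h i (isUnit_of_map_unit φ _ (isUnit_iff_ne_zero.2 h1))
    have h1 : (φ.comp (PowerSeries.constantCoeff (R := A))) k.det = 0 := by
      rw [RingHom.map_det]
      exact det_eq_zero_of_column_eq_zero j h0
    exact (hk.map (φ.comp (PowerSeries.constantCoeff (R := A)))).ne_zero h1
  classical
  obtain ⟨i, hi, hmin⟩ := Finset.exists_min_image
    (Finset.univ.filter fun i => IsUnit (PowerSeries.constantCoeff (k i j))) μ
    (hex.imp fun i hi => by simpa using hi)
  replace hi : IsUnit (PowerSeries.constantCoeff (k i j)) := by simpa using hi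
  obtain ⟨v, hvi, hv, hvk⟩ := exists_colMatrix_clear φ i j k hi
  obtain ⟨k2, hk2, hdet⟩ := exists_diagX_mul_eq i j _ hvk
  obtain ⟨p2, hp2, q2, hq2, e2⟩ := exists_diagPow_mul_colMatrix (φ := φ) μ hvi (by
    intro a ha
    refine hv a ?_
    by_contra h1
    refine absurd (hmin a ?_) (not_le.2 ha)
    simpa using isUnit_of_map_unit φ _ (isUnit_iff_ne_zero.2 h1))
  obtain ⟨p3, hp3, q3, hq3, e3⟩ := isSwappable_of_mem_elemMonoid hm hp2 q hq
  refine ⟨p * p3, mul_mem hp hp3, q3 * q2, by rw [map_mul, hq3, hq2, mul_one],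
    μ + Pi.single i 1, k2, ?_, ?_⟩
  · rw [hdet, det_mul]
    refine IsUnit.mul ?_ hk
    refine isUnit_det_of_left_inverse (B := colMatrix i fun a => PowerSeries.C (v a)) ?_
    rw [colMatrix_mul_colMatrix i _ _ (by simp [hvi]), ← colMatrix_zero i]
    congr 1
    ext1 b
    simp
  · rw [map_mul, map_mul, diagPow_add]
    refine mul_eq_mul_of_factor (D' := diagPow A (-Pi.single i 1))
      (V' := (powerToLaurent A).mapMatrix (colMatrix i fun a => PowerSeries.C (-v a)))
      (F' := diagPow A (-Pi.single j 1)) ?_ ?_ ?_ ?_ e2 e3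
    · rw [← diagPow_add, add_neg_cancel, diagPow_zero]
    · rw [← diagPow_add, neg_add_cancel, diagPow_zero]
    · rw [← map_mul, colMatrix_mul_colMatrix i _ _ (by simp [hvi]),
        ← map_one (powerToLaurent A).mapMatrix, ← colMatrix_zero i]
      congr 2
      ext1 b
      simp
    · rw [← powerToLaurent_diagX, ← powerToLaurent_diagX, ← map_mul, ← map_mul, ← map_mul, hk2]

theorem HasFactorization.mul_diagPow [IsLocalHom φ] (hm : 3 ≤ m)
    {x : Matrix (Fin m) (Fin m) (LaurentSeries A)} (hx : HasFactorization φ x) (μ : Fin m → ℤ) :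
    HasFactorization φ (x * diagPow A μ) := by
  let G : AddSubmonoid (Fin m → ℤ) :=
    { carrier := { μ | ∀ x : Matrix (Fin m) (Fin m) (LaurentSeries A),
        HasFactorization φ x → HasFactorization φ (x * diagPow A μ) }
      zero_mem' := fun x hx => by simpa using hx
      add_mem' := fun hμ hν x hx => by
        rw [diagPow_add, ← mul_assoc]
        exact hν _ (hμ _ hx) }
  have h1 : ∀ i, Pi.single i 1 ∈ G := fun i x hx => hx.mul_diagPow_single hm i
  have h2 : ∀ i, Pi.single i (-1) ∈ G := by
    intro i
    have : (Pi.single i (-1) : Fin m → ℤ) =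
        (fun _ => -1) + ∑ k ∈ Finset.univ.erase i, Pi.single k 1 := by
      ext k
      by_cases hk : k = i <;> simp [Finset.sum_apply, Pi.single_apply, hk]
    rw [this]
    exact add_mem (fun x hx => hx.mul_diagPow_const _) (sum_mem fun k _ => h1 k)
  suffices H : μ ∈ G from H x hx
  rw [← Finset.univ_sum_single μ]
  refine sum_mem fun i _ => ?_
  obtain ⟨n, hn | hn⟩ := (μ i).eq_nat_or_neg
  · have : (Pi.single i (μ i) : Fin m → ℤ) = n • Pi.single i 1 := by
      rw [hn, ← Pi.single_smul]; simp
    rw [this]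
    exact nsmul_mem (h1 i) n
  · have : (Pi.single i (μ i) : Fin m → ℤ) = n • Pi.single i (-1) := by
      rw [hn, ← Pi.single_smul]; simp
    rw [this]
    exact nsmul_mem (h2 i) n

theorem exists_eq_single_mul_powerToLaurent (x : LaurentSeries A) :
    ∃ (n : ℤ) (f : PowerSeries A), x = HahnSeries.single n 1 * powerToLaurent A f :=
  ⟨_, _, (LaurentSeries.single_order_mul_powerSeriesPart x).symm⟩

theorem HasFactorization.mul_of_mem_elemMonoid [IsLocalHom φ] (hm : 3 ≤ m)
    {x y : Matrix (Fin m) (Fin m) (LaurentSeries A)}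
    (hx : HasFactorization φ x) (hy : y ∈ elemMonoid m (LaurentSeries A)) :
    HasFactorization φ (x * y) := by
  induction hy using Submonoid.closure_induction generalizing x with
  | mem y hy =>
    obtain ⟨i, j, a, hij, rfl⟩ := hy
    obtain ⟨n, f, rfl⟩ := exists_eq_single_mul_powerToLaurent a
    have : transvection i j (HahnSeries.single n 1 * powerToLaurent A f) =
        diagPow A (-Pi.single i n) *
          ((powerToLaurent A).mapMatrix (transvection i j f)) * diagPow A (Pi.single i n) := by
      rw [mapMatrix_transvection, transvection_eq_colMatrix, transvection_eq_colMatrix,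
        diagPow_mul_colMatrix (w' := Pi.single i (HahnSeries.single n 1 * powerToLaurent A f)),
        mul_assoc, ← diagPow_add, neg_add_cancel, diagPow_zero, mul_one]
      intro a
      by_cases ha : a = i
      · subst ha
        simp [hij.symm]
      · simp [ha]
    rw [this, ← mul_assoc, ← mul_assoc]
    refine ((hx.mul_diagPow hm _).mul_powerToLaurent ?_).mul_diagPow hm _
    rw [det_transvection_of_ne i j hij]
    exact isUnit_one
  | one => rwa [mul_one]
  | mul y z _ _ hy hz =>
    rw [← mul_assoc]
    exact hz (hy hx)

end Factorization

section LocalTheorem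

open Polynomial

variable {m : ℕ} {A B : Type*} [CommRing A] [CommRing B] (φ : A →+* B)

/-- The map of Laurent series induced by a ring homomorphism. -/
noncomputable def laurentMap : LaurentSeries A →+* LaurentSeries B where
  toFun x := HahnSeries.map x φ
  map_one' := HahnSeries.map_one φ.toMonoidWithZeroHom
  map_mul' _ _ := HahnSeries.map_mul φ.toNonUnitalRingHom
  map_zero' := by ext; simp
  map_add' _ _ := by ext; simp

@[simp]
theorem coeff_laurentMap (x : LaurentSeries A) (n : ℤ) :
    (laurentMap φ x).coeff n = φ (x.coeff n) := rfl

@[simp]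
theorem laurentMap_single (n : ℤ) (a : A) :
    laurentMap φ (HahnSeries.single n a) = HahnSeries.single n (φ a) := by
  ext k
  rw [coeff_laurentMap, HahnSeries.coeff_single, HahnSeries.coeff_single]
  split_ifs <;> simp

theorem laurentMap_comp_powerToLaurent :
    (laurentMap φ).comp (powerToLaurent A) = (powerToLaurent B).comp (PowerSeries.map φ) := by
  refine RingHom.ext fun f => ?_
  ext n
  rw [RingHom.comp_apply, RingHom.comp_apply, coeff_laurentMap]
  obtain ⟨n, rfl⟩ | hn : (∃ k : ℕ, n = k) ∨ n < 0 := by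
    rcases lt_or_ge n 0 with h | h
    · exact Or.inr h
    · exact Or.inl (Int.eq_ofNat_of_zero_le h)
  · rw [HahnSeries.ofPowerSeries_apply_coeff, HahnSeries.ofPowerSeries_apply_coeff,
      PowerSeries.coeff_map]
  · rw [coeff_powerToLaurent_of_neg _ hn, coeff_powerToLaurent_of_neg _ hn, map_zero]

theorem laurentMap_comp_polyToLaurent :
    (laurentMap φ).comp (polyToLaurent A) = (polyToLaurent B).comp (mapRingHom φ) := by
  apply Polynomial.ringHom_ext
  · intro a; simp [HahnSeries.C_apply]
  · simp

theorem laurentMap_diagPow (μ : Fin m → ℤ) :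
    (laurentMap φ).mapMatrix (diagPow A μ) = diagPow B μ := by
  rw [diagPow, diagPow, RingHom.mapMatrix_apply, diagonal_map (map_zero _)]
  congr 1
  ext1 k
  simp

theorem nonneg_of_polyToLaurent_eq {κ : Type*} [Field κ] {Y : Matrix (Fin m) (Fin m) κ[X]}
    {K : Matrix (Fin m) (Fin m) (PowerSeries κ)} (hK : IsUnit K.det) {μ : Fin m → ℤ}
    (h : (polyToLaurent κ).mapMatrix Y = diagPow κ μ * (powerToLaurent κ).mapMatrix K)
    (i : Fin m) : 0 ≤ μ i := by
  by_contra! hi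
  refine hK.ne_zero (det_eq_zero_of_row_eq_zero i fun j => ?_)
  have hij := congrFun (congrFun h i) j
  rw [diagPow_mul_apply, RingHom.mapMatrix_apply, RingHom.mapMatrix_apply, Matrix.map_apply,
    Matrix.map_apply] at hij
  have h0 : Y i j = 0 := eq_zero_of_polyToLaurent_eq (by omega) hij
  rw [h0, map_zero, eq_comm, mul_eq_zero] at hij
  rcases hij with hij | hij
  · simp at hij
  · exact HahnSeries.ofPowerSeries_injective (hij.trans (map_zero _).symm)

/-- A polynomial matrix over a local ring that becomes, over Laurent series in the inverse
variable, the product of an elementary matrix and an invertible matrix over power series, is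
elementary up to a constant factor. -/
theorem mul_evalZeroC_mem_elemMonoid (hm : 3 ≤ m) {κ : Type*} [Field κ] (φ : A →+* κ)
    [IsLocalHom φ] {g g' : Matrix (Fin m) (Fin m) A[X]} (hg : g * g' = 1)
    {γ : Matrix (Fin m) (Fin m) (LaurentSeries A)} (hγ : γ ∈ elemMonoid m (LaurentSeries A))
    {k₀ : Matrix (Fin m) (Fin m) (PowerSeries A)} (hk₀ : IsUnit k₀.det)
    (h : (polyToLaurent A).mapMatrix g = γ * (powerToLaurent A).mapMatrix k₀) :
    g * (evalZeroC A).mapMatrix g' ∈ elemMonoid m A[X] := by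
  have hg' : g' * g = 1 := mul_eq_one_comm.1 hg
  obtain ⟨p, hp, q, hq, μ, k, hk, e⟩ :=
    ((hasFactorization_one (φ := φ)).mul_of_mem_elemMonoid hm hγ).mul_powerToLaurent hk₀
  rw [one_mul, ← h] at e
  obtain ⟨p', hp', hpp', hp'p⟩ := exists_inverse_of_mem_elemMonoid hp
  have hy : (polyToLaurent A).mapMatrix (p' * g) =
      (powerToLaurent A).mapMatrix q * diagPow A μ * (powerToLaurent A).mapMatrix k := by
    rw [map_mul, e, ← mul_assoc, ← mul_assoc, ← mul_assoc, ← map_mul, hp'p, map_one, one_mul]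
  set Y : Matrix (Fin m) (Fin m) κ[X] := (mapRingHom φ).mapMatrix (p' * g) with hY
  set Y' : Matrix (Fin m) (Fin m) κ[X] := (mapRingHom φ).mapMatrix (g' * p) with hY'
  set K : Matrix (Fin m) (Fin m) (PowerSeries κ) := (PowerSeries.map φ).mapMatrix k with hK
  have hYY' : Y' * Y = 1 := by
    rw [hY, hY', ← map_mul, mul_assoc, ← mul_assoc p, hpp', one_mul, hg', map_one]
  have hKdet : IsUnit K.det := by
    rw [hK, ← RingHom.map_det]
    exact hk.map _
  have hYK : (polyToLaurent κ).mapMatrix Y = diagPow κ μ * (powerToLaurent κ).mapMatrix K := by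
    have := congrArg (laurentMap φ).mapMatrix hy
    rw [mapMatrix_mapMatrix, map_mul (laurentMap φ).mapMatrix, map_mul (laurentMap φ).mapMatrix,
      mapMatrix_mapMatrix, mapMatrix_mapMatrix,
      laurentMap_comp_polyToLaurent, laurentMap_comp_powerToLaurent,
      ← mapMatrix_mapMatrix _ _ (p' * g),
      ← mapMatrix_mapMatrix _ _ q, ← mapMatrix_mapMatrix _ _ k, hq, map_one, one_mul,
      laurentMap_diagPow] at this
    exact this
  have hYK' : (polyToLaurent κ).mapMatrix Y'ᵀ =
      diagPow κ (-μ) * (powerToLaurent κ).mapMatrix K⁻¹ᵀ := by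
    rw [mapMatrix_transpose, mapMatrix_transpose, ← transpose_inj, transpose_mul,
      transpose_transpose, transpose_transpose, diagPow_transpose]
    have h1 : (polyToLaurent κ).mapMatrix Y' *
        (diagPow κ μ * (powerToLaurent κ).mapMatrix K) = 1 := by
      rw [← hYK, ← map_mul, hYY', map_one]
    have h2 : diagPow κ μ * (powerToLaurent κ).mapMatrix K *
        ((powerToLaurent κ).mapMatrix K⁻¹ * diagPow κ (-μ)) = 1 := by
      rw [mul_assoc, ← mul_assoc ((powerToLaurent κ).mapMatrix K), ← map_mul,
        mul_nonsing_inv _ hKdet, map_one, one_mul, ← diagPow_add, add_neg_cancel, diagPow_zero]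
    exact left_inv_eq_right_inv h1 h2
  have hμ : μ = 0 := by
    ext i
    have h1 := nonneg_of_polyToLaurent_eq hKdet hYK i
    have h2 := nonneg_of_polyToLaurent_eq
      (by rw [det_transpose]; exact isUnit_nonsing_inv_det _ hKdet) hYK' i
    rw [Pi.neg_apply] at h2
    rw [Pi.zero_apply]
    omega
  have hconst : (evalZeroC A).mapMatrix (p' * g) = p' * g := by
    rw [hμ, diagPow_zero, mul_one, ← map_mul] at hy
    ext1 i j
    have := eq_C_of_polyToLaurent_eq (congrFun (congrFun hy i) j)
    rw [RingHom.mapMatrix_apply, Matrix.map_apply]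
    conv_rhs => rw [this]
    simp [evalZeroC, coeff_zero_eq_eval_zero]
  have hfinal : g * (evalZeroC A).mapMatrix g' = p * (evalZeroC A).mapMatrix p' := by
    calc g * (evalZeroC A).mapMatrix g' = p * (p' * g) * (evalZeroC A).mapMatrix g' := by
          rw [← mul_assoc p, hpp', one_mul]
      _ = p * (evalZeroC A).mapMatrix p' := by
          rw [← hconst, mul_assoc, ← map_mul, mul_assoc, hg, mul_one]
  rw [hfinal]
  exact mul_mem hp (mapMatrix_mem_elemMonoid _ hp')

end LocalTheorem

section ConstantFactor

open Polynomial

variable {m : ℕ} {A : Type*} [CommRing A]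

theorem mul_evalZeroC_mem_elemMonoid_of_eq_mul_C (hm : 3 ≤ m) {g g' : Matrix (Fin m) (Fin m) A[X]}
    {γ : Matrix (Fin m) (Fin m) (LaurentSeries A)} {c : Matrix (Fin m) (Fin m) A}
    (hg : g * g' = 1) (hγ : γ ∈ elemMonoid m (LaurentSeries A)) (hc : IsUnit c.det)
    (h : (polyToLaurent A).mapMatrix g =
      γ * (powerToLaurent A).mapMatrix ((PowerSeries.C (R := A)).mapMatrix c)) :
    g * (evalZeroC A).mapMatrix g' ∈ elemMonoid m A[X] := by
  have hg' : g' * g = 1 := mul_eq_one_comm.1 hg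
  have e0 : ∀ M : Matrix (Fin m) (Fin m) A[X],
      (evalZeroC A).mapMatrix ((evalZeroC A).mapMatrix M) = (evalZeroC A).mapMatrix M := fun M => by
    rw [mapMatrix_mapMatrix, evalZeroC_comp_evalZeroC]
  refine mem_elemMonoid_of_localization hm (g' := (evalZeroC A).mapMatrix g * g') ?_ ?_ ?_ ?_
  · rw [mul_assoc, ← mul_assoc _ _ g', ← map_mul, hg', map_one, one_mul, hg]
  · rw [mul_assoc, ← mul_assoc g', hg', one_mul, ← map_mul, hg, map_one]
  · rw [map_mul, e0, ← map_mul, hg, map_one]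
  · intro p hp
    set φ := algebraMap A (Localization.AtPrime p)
    have e1 : (mapRingHom φ).mapMatrix ((evalZeroC A).mapMatrix g') =
        (evalZeroC _).mapMatrix ((mapRingHom φ).mapMatrix g') := by
      rw [mapMatrix_mapMatrix, mapMatrix_mapMatrix, mapRingHom_comp_evalZeroC]
    rw [map_mul, e1]
    refine mul_evalZeroC_mem_elemMonoid hm (IsLocalRing.residue (Localization.AtPrime p))
      (k₀ := (PowerSeries.map φ).mapMatrix ((PowerSeries.C (R := A)).mapMatrix c)) ?_
      (mapMatrix_mem_elemMonoid (laurentMap φ) hγ) ?_ ?_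
    · rw [← map_mul, hg, map_one]
    · rw [← RingHom.map_det, ← RingHom.map_det]
      exact (hc.map _).map _
    · rw [mapMatrix_mapMatrix, ← laurentMap_comp_polyToLaurent, ← mapMatrix_mapMatrix, h,
        map_mul (laurentMap φ).mapMatrix, mapMatrix_mapMatrix (laurentMap φ),
        laurentMap_comp_powerToLaurent]
      rfl

end ConstantFactor

section Approximation

open Polynomial
open scoped LaurentPolynomial

variable {m : ℕ} {A : Type*} [CommRing A]

theorem isUnit_polyToLaurent_of_monic {f : A[X]} (hf : f.Monic) : IsUnit (polyToLaurent A f) := by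
  let inv : Invertible (HahnSeries.single (-1 : ℤ) (1 : A)) :=
    ⟨HahnSeries.single 1 1, by simp, by simp⟩
  have h := eval₂_reverse_mul_pow (HahnSeries.C : A →+* LaurentSeries A)
    (HahnSeries.single (-1 : ℤ) (1 : A)) f
  have e : eval₂ (HahnSeries.C : A →+* LaurentSeries A)
      (⅟(HahnSeries.single (-1 : ℤ) (1 : A))) f.reverse =
      powerToLaurent A (f.reverse : PowerSeries A) := by
    have : eval₂RingHom (HahnSeries.C : A →+* LaurentSeries A) (HahnSeries.single (1 : ℤ) (1 : A)) =
        (powerToLaurent A).comp Polynomial.coeToPowerSeries.ringHom := by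
      ext1
      · exact RingHom.ext fun x => by simp
      · simp
    exact congrArg (fun ψ : A[X] →+* LaurentSeries A => ψ f.reverse) this
  rw [e] at h
  change IsUnit (eval₂ _ _ f)
  rw [← h]
  refine IsUnit.mul (IsUnit.map _ ?_) (IsUnit.pow _ (isUnit_of_invertible _))
  rw [PowerSeries.isUnit_iff_constantCoeff]
  simp [hf.leadingCoeff]

/-- The embedding of Laurent polynomials into Laurent series. -/
noncomputable def laurentPolyToLaurent (A : Type*) [CommRing A] : A[T;T⁻¹] →+* LaurentSeries A :=
  LaurentPolynomial.eval₂ HahnSeries.C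
    ⟨HahnSeries.single 1 1, HahnSeries.single (-1) 1, by simp, by simp⟩

theorem laurentPolyToLaurent_comp_toLaurent :
    (laurentPolyToLaurent A).comp toLaurent =
      (powerToLaurent A).comp Polynomial.coeToPowerSeries.ringHom := by
  ext1
  · exact RingHom.ext fun x => by simp [laurentPolyToLaurent]
  · simp [laurentPolyToLaurent]

theorem laurentPolyToLaurent_toLaurent (p : A[X]) :
    laurentPolyToLaurent A (toLaurent p) = powerToLaurent A p :=
  congrArg (fun ψ : A[X] →+* LaurentSeries A => ψ p) laurentPolyToLaurent_comp_toLaurent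

theorem laurentPolyToLaurent_T (n : ℤ) :
    laurentPolyToLaurent A (LaurentPolynomial.T n) = HahnSeries.single n 1 := by
  have h : ∀ k : ℕ, laurentPolyToLaurent A (LaurentPolynomial.T k) =
      HahnSeries.single (k : ℤ) 1 := by
    intro k
    simp [laurentPolyToLaurent, HahnSeries.single_pow]
  obtain ⟨k, rfl | rfl⟩ := n.eq_nat_or_neg
  · exact h k
  · rw [laurentPolyToLaurent, LaurentPolynomial.eval₂_T_neg_n]
    simp [HahnSeries.single_pow]

theorem laurentPolyToLaurent_comp_invert :
    ((laurentPolyToLaurent A).comp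
      (LaurentPolynomial.invert : A[T;T⁻¹] ≃ₐ[A] A[T;T⁻¹]).toRingEquiv.toRingHom).comp toLaurent =
      polyToLaurent A := by
  ext1
  · exact RingHom.ext fun x => by simp [laurentPolyToLaurent]
  · simp [laurentPolyToLaurent_T]

theorem exists_eq_toLaurent {z : A[T;T⁻¹]} {f : PowerSeries A}
    (h : laurentPolyToLaurent A z = powerToLaurent A f) :
    ∃ p : A[X], z = toLaurent p ∧ (p : PowerSeries A) = f := by
  obtain ⟨n, q, hq⟩ := z.exists_T_pow
  have h1 : (q : PowerSeries A) = PowerSeries.X ^ n * f := by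
    refine HahnSeries.ofPowerSeries_injective (Γ := ℤ) ?_
    have := congrArg (laurentPolyToLaurent A) hq
    rw [laurentPolyToLaurent_toLaurent, map_mul, h, laurentPolyToLaurent_T] at this
    rw [this, map_mul, mul_comm]
    simp
  obtain ⟨p, rfl⟩ : X ^ n ∣ q := by
    rw [X_pow_dvd_iff]
    intro d hd
    rw [← coeff_coe, h1, PowerSeries.coeff_X_pow_mul', if_neg (by omega)]
  refine ⟨p, ?_, ?_⟩
  · rw [map_mul, toLaurent_X_pow, mul_comm] at hq
    exact ((LaurentPolynomial.isUnit_T (R := A) n).mul_left_injective hq).symm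
  · rw [coe_mul, coe_pow, coe_X] at h1
    exact PowerSeries.X_pow_mul_cancel h1

theorem exists_eq_add_X_pow_mul (x : LaurentSeries A) (N : ℕ) :
    ∃ (x' : A[T;T⁻¹]) (z : PowerSeries A),
      x = laurentPolyToLaurent A x' + powerToLaurent A (PowerSeries.X ^ N * z) := by
  obtain ⟨n, f, rfl⟩ := exists_eq_single_mul_powerToLaurent x
  have key := f.eq_X_pow_mul_shift_add_trunc (N + n.natAbs)
  set f₁ : PowerSeries A := PowerSeries.mk fun i => PowerSeries.coeff (i + (N + n.natAbs)) f
  refine ⟨LaurentPolynomial.T n * toLaurent (f.trunc (N + n.natAbs)),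
    PowerSeries.X ^ (n + n.natAbs).toNat * f₁, ?_⟩
  rw [map_mul, laurentPolyToLaurent_T, laurentPolyToLaurent_toLaurent]
  conv_lhs => rw [key]
  rw [map_add, mul_add, add_comm]
  congr 1
  rw [← mul_assoc, ← pow_add, map_mul, map_mul, ← mul_assoc]
  congr 1
  rw [HahnSeries.ofPowerSeries_X_pow, HahnSeries.ofPowerSeries_X_pow, HahnSeries.single_mul_single,
    mul_one]
  congr 2
  omega

theorem exists_eq_single_smul (P : Matrix (Fin m) (Fin m) (LaurentSeries A)) :
    ∃ (r : ℕ) (Q : Matrix (Fin m) (Fin m) (PowerSeries A)),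
      P = (HahnSeries.single (-r : ℤ) (1 : A) : LaurentSeries A) •
        (powerToLaurent A).mapMatrix Q := by
  choose n f hf using fun i j => exists_eq_single_mul_powerToLaurent (P i j)
  refine ⟨∑ i, ∑ j, (n i j).natAbs,
    .of fun i j => PowerSeries.X ^ (n i j + (∑ i, ∑ j, (n i j).natAbs : ℕ)).toNat * f i j, ?_⟩
  ext1 i j
  have h1 : (n i j).natAbs ≤ ∑ j, (n i j).natAbs :=
    Finset.single_le_sum (f := fun j => (n i j).natAbs) (fun _ _ => Nat.zero_le _)
      (Finset.mem_univ j)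
  have h2 : ∑ j, (n i j).natAbs ≤ ∑ i, ∑ j, (n i j).natAbs :=
    Finset.single_le_sum (f := fun i => ∑ j, (n i j).natAbs) (fun _ _ => Nat.zero_le _)
      (Finset.mem_univ i)
  generalize ∑ i, ∑ j, (n i j).natAbs = r at *
  rw [hf, Matrix.smul_apply, RingHom.mapMatrix_apply, Matrix.map_apply, Matrix.of_apply, map_mul,
    smul_eq_mul, ← mul_assoc, HahnSeries.ofPowerSeries_X_pow, HahnSeries.single_mul_single, mul_one]
  congr 3
  omega

theorem powerToLaurent_X_pow_smul (n : ℕ) (y : Matrix (Fin m) (Fin m) (PowerSeries A)) :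
    (powerToLaurent A).mapMatrix ((PowerSeries.X ^ n : PowerSeries A) • y) =
      (HahnSeries.single (n : ℤ) (1 : A) : LaurentSeries A) • (powerToLaurent A).mapMatrix y := by
  ext1 i j
  simp [HahnSeries.ofPowerSeries_X_pow]

theorem exists_mul_X_pow_smul_mul_eq (P Q : Matrix (Fin m) (Fin m) (LaurentSeries A)) :
    ∃ r : ℕ, ∀ (N : ℕ) (y : Matrix (Fin m) (Fin m) (PowerSeries A)),
      ∃ y' : Matrix (Fin m) (Fin m) (PowerSeries A),
        P * (powerToLaurent A).mapMatrix ((PowerSeries.X ^ (N + r) : PowerSeries A) • y) * Q =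
          (powerToLaurent A).mapMatrix ((PowerSeries.X ^ N : PowerSeries A) • y') := by
  obtain ⟨r, P', rfl⟩ := exists_eq_single_smul P
  obtain ⟨s, Q', rfl⟩ := exists_eq_single_smul Q
  refine ⟨r + s, fun N y => ⟨P' * y * Q', ?_⟩⟩
  rw [powerToLaurent_X_pow_smul, powerToLaurent_X_pow_smul, smul_mul_smul_comm,
    smul_mul_smul_comm, map_mul (powerToLaurent A).mapMatrix, map_mul (powerToLaurent A).mapMatrix,
    HahnSeries.single_mul_single, HahnSeries.single_mul_single, mul_one, mul_one]
  congr 3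
  push_cast
  omega

theorem exists_laurentPoly_approximation {γ : Matrix (Fin m) (Fin m) (LaurentSeries A)}
    (hγ : γ ∈ elemMonoid m (LaurentSeries A)) (N : ℕ) :
    ∃ γ' ∈ elemMonoid m A[T;T⁻¹], ∃ y : Matrix (Fin m) (Fin m) (PowerSeries A),
      γ = (laurentPolyToLaurent A).mapMatrix γ' *
        (powerToLaurent A).mapMatrix (1 + (PowerSeries.X ^ N : PowerSeries A) • y) := by
  induction hγ using Submonoid.closure_induction_right generalizing N with
  | one => exact ⟨1, one_mem _, 0, by simp⟩
  | mul_right M hM e he ih =>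
    obtain ⟨i, j, x, hij, rfl⟩ := he
    obtain ⟨x', z, rfl⟩ := exists_eq_add_X_pow_mul x N
    set ε := (laurentPolyToLaurent A).mapMatrix (transvection i j x') with hε
    set ε' := (laurentPolyToLaurent A).mapMatrix (transvection i j (-x')) with hε'
    have hεε' : ε * ε' = 1 := by
      rw [hε, hε', ← map_mul, transvection_mul_transvection_same i j hij, add_neg_cancel,
        transvection_zero, map_one]
    have hε'ε : ε' * ε = 1 := mul_eq_one_comm.1 hεε'
    obtain ⟨r, hr⟩ := exists_mul_X_pow_smul_mul_eq ε' ε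
    obtain ⟨γ', hγ', y, rfl⟩ := ih (N + r)
    obtain ⟨y', hy'⟩ := hr N y
    refine ⟨γ' * transvection i j x', mul_mem hγ' (transvection_mem_elemMonoid hij _),
      y' + (1 + (PowerSeries.X ^ N : PowerSeries A) • y') * single i j z, ?_⟩
    have e1 : transvection i j
          (laurentPolyToLaurent A x' + powerToLaurent A (PowerSeries.X ^ N * z)) =
        ε * (powerToLaurent A).mapMatrix
          (1 + (PowerSeries.X ^ N : PowerSeries A) • single i j z) := by
      rw [← transvection_mul_transvection_same i j hij, ← mapMatrix_transvection,
        ← mapMatrix_transvection, hε, transvection, transvection, smul_single, smul_eq_mul]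
    have e2 : (1 + (PowerSeries.X ^ N : PowerSeries A) •
          (y' + (1 + (PowerSeries.X ^ N : PowerSeries A) • y') * single i j z)) =
        (1 + (PowerSeries.X ^ N : PowerSeries A) • y') *
          (1 + (PowerSeries.X ^ N : PowerSeries A) • single i j z) := by
      rw [mul_add, mul_one, smul_add, mul_smul_comm, add_assoc]
    have e3 : (powerToLaurent A).mapMatrix (1 + (PowerSeries.X ^ (N + r) : PowerSeries A) • y) * ε =
        ε * (powerToLaurent A).mapMatrix (1 + (PowerSeries.X ^ N : PowerSeries A) • y') := by
      rw [map_add, map_add, ← hy', map_one, mul_add, add_mul, mul_one, one_mul, ← mul_assoc,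
        ← mul_assoc, hεε', one_mul]
    rw [e1, e2, map_mul (powerToLaurent A).mapMatrix, map_mul (laurentPolyToLaurent A).mapMatrix,
      ← hε, ← mul_assoc, mul_assoc _ _ ε, e3]
    simp only [mul_assoc]

theorem mem_elemMonoid_of_map_C_mem (hm : 3 ≤ m) {c c' : Matrix (Fin m) (Fin m) A} (hc : c * c' = 1)
    (h : (powerToLaurent A).mapMatrix ((PowerSeries.C (R := A)).mapMatrix c) ∈
      elemMonoid m (LaurentSeries A)) :
    c ∈ elemMonoid m A := by
  obtain ⟨γ, hγ, y, hy⟩ := exists_laurentPoly_approximation h 1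
  obtain ⟨δ, hδ, hγδ, hδγ⟩ := exists_inverse_of_mem_elemMonoid hγ
  have hδdet : δ.det = 1 := by
    obtain ⟨δ', -, rfl⟩ := exists_mem_elemSubgroup_of_mem_elemMonoid hδ
    exact δ'.2
  have hcdet : IsUnit c.det := IsUnit.of_mul_eq_one c'.det (by rw [← det_mul, hc, det_one])
  have hCC : (laurentPolyToLaurent A).comp LaurentPolynomial.C =
      (powerToLaurent A).comp PowerSeries.C :=
    RingHom.ext fun a => by simp [laurentPolyToLaurent]
  set z := δ * (LaurentPolynomial.C (R := A)).mapMatrix c with hz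
  have hσz : (laurentPolyToLaurent A).mapMatrix z =
      (powerToLaurent A).mapMatrix (1 + (PowerSeries.X ^ 1 : PowerSeries A) • y) := by
    rw [hz, map_mul, mapMatrix_mapMatrix _ LaurentPolynomial.C, hCC, ← mapMatrix_mapMatrix, hy,
      ← mul_assoc, ← map_mul, hδγ, map_one, one_mul]
  choose p hp hpy using fun i j => exists_eq_toLaurent (congrFun (congrFun hσz i) j)
  let P : Matrix (Fin m) (Fin m) A[X] := .of p
  have hzP : toLaurent.mapMatrix P = z := by
    ext1 i j
    exact (hp i j).symm
  have hP0 : (evalZeroC A).mapMatrix P = 1 := by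
    ext1 i j
    have h0 : (p i j).coeff 0 = (1 : Matrix (Fin m) (Fin m) A) i j := by
      rw [← coeff_coe, hpy, Matrix.add_apply, map_add, Matrix.smul_apply, pow_one, smul_eq_mul,
        PowerSeries.coeff_zero_X_mul, add_zero, Matrix.one_apply, Matrix.one_apply]
      split_ifs <;> simp
    have h1 : evalZeroC A (p i j) = C ((p i j).coeff 0) := by
      simp [evalZeroC, coeff_zero_eq_eval_zero]
    rw [RingHom.mapMatrix_apply, Matrix.map_apply, show P i j = p i j from rfl, h1, h0,
      Matrix.one_apply, Matrix.one_apply]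
    split_ifs <;> simp
  have hdet : P.det = C c.det := by
    apply toLaurent_injective
    rw [RingHom.map_det, hzP, hz, det_mul, hδdet, one_mul, ← RingHom.map_det, toLaurent_C]
  have hPP' : P * P⁻¹ = 1 := mul_nonsing_inv _ (by rw [hdet]; exact hcdet.map C)
  have hP0' : (evalZeroC A).mapMatrix P⁻¹ = 1 := by
    rw [← one_mul ((evalZeroC A).mapMatrix P⁻¹), ← hP0, ← map_mul, hPP', map_one, hP0]
  set ν := (LaurentPolynomial.invert : A[T;T⁻¹] ≃ₐ[A] A[T;T⁻¹]).toRingEquiv.toRingHom with hν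
  have hπ : (polyToLaurent A).mapMatrix P = (laurentPolyToLaurent A).mapMatrix (ν.mapMatrix δ) *
      (powerToLaurent A).mapMatrix ((PowerSeries.C (R := A)).mapMatrix c) := by
    rw [← laurentPolyToLaurent_comp_invert, ← mapMatrix_mapMatrix, hzP, hz, ← mapMatrix_mapMatrix,
      map_mul ν.mapMatrix, map_mul (laurentPolyToLaurent A).mapMatrix, mapMatrix_mapMatrix ν]
    have : ν.comp LaurentPolynomial.C = LaurentPolynomial.C := RingHom.ext fun a => by simp [hν]
    rw [this, mapMatrix_mapMatrix _ LaurentPolynomial.C, hCC, ← mapMatrix_mapMatrix]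
  have hPE := mul_evalZeroC_mem_elemMonoid_of_eq_mul_C hm hPP'
    (mapMatrix_mem_elemMonoid _ (mapMatrix_mem_elemMonoid ν hδ)) hcdet hπ
  rw [hP0', mul_one] at hPE
  let ev : A[T;T⁻¹] →+* A := LaurentPolynomial.eval₂ (RingHom.id A) 1
  have h1 : ev.mapMatrix z = ev.mapMatrix δ * c := by
    rw [hz, map_mul, mapMatrix_mapMatrix]
    have : ev.comp LaurentPolynomial.C = RingHom.id A := RingHom.ext fun a => by simp [ev]
    rw [this]
    simp
  refine mem_elemMonoid_of_mul_mem_left (mapMatrix_mem_elemMonoid ev hδ) ?_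
  rw [← h1, ← hzP, mapMatrix_mapMatrix]
  exact mapMatrix_mem_elemMonoid _ hPE

theorem mem_elemMonoid_of_polyToLaurent_mem (hm : 3 ≤ m) {M M' : Matrix (Fin m) (Fin m) A[X]}
    (hM : M * M' = 1) (h : (polyToLaurent A).mapMatrix M ∈ elemMonoid m (LaurentSeries A)) :
    M ∈ elemMonoid m A[X] := by
  have hM' : M' * M = 1 := mul_eq_one_comm.1 hM
  have hN : M * (evalZeroC A).mapMatrix M' ∈ elemMonoid m A[X] :=
    mul_evalZeroC_mem_elemMonoid_of_eq_mul_C hm (c := 1) hM h (by simp)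
      (by rw [map_one, map_one, mul_one])
  have hsplit : M * (evalZeroC A).mapMatrix M' * (evalZeroC A).mapMatrix M = M := by
    rw [mul_assoc, ← map_mul, hM', map_one, mul_one]
  have hev : evalZeroC A = C.comp (evalRingHom 0) := by
    ext1
    · exact RingHom.ext fun x => by simp
    · simp
  have hc : (evalRingHom (0 : A)).mapMatrix M ∈ elemMonoid m A := by
    refine mem_elemMonoid_of_map_C_mem hm (c' := (evalRingHom (0 : A)).mapMatrix M')
      (by rw [← map_mul, hM, map_one]) ?_
    have hC : (powerToLaurent A).comp PowerSeries.C = (polyToLaurent A).comp C :=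
      RingHom.ext fun a => by simp
    change ((powerToLaurent A).comp PowerSeries.C).mapMatrix _ ∈ _
    rw [hC, ← mapMatrix_mapMatrix, mapMatrix_mapMatrix C, ← hev]
    refine mem_elemMonoid_of_mul_mem_left (mapMatrix_mem_elemMonoid (polyToLaurent A) hN) ?_
    rwa [← map_mul, hsplit]
  rw [← hsplit]
  refine mul_mem hN ?_
  rw [hev, ← mapMatrix_mapMatrix]
  exact mapMatrix_mem_elemMonoid _ hc

end Approximation

/-- For a monic polynomial `f ∈ A[t]`, the natural map
`K1^{SL_m}(A[t]) → K1^{SL_m}(A[t]_f)` is injective for `m ≥ 3`. -/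
theorem k1_poly_to_localization_monic_injective (A : Type*) [CommRing A] (m : ℕ)
    (hm : 3 ≤ m) (f : Polynomial A) (hf : f.Monic)
    (g : SpecialLinearGroup (Fin m) (Polynomial A))
    (h : SpecialLinearGroup.map (algebraMap (Polynomial A) (Localization.Away f)) g
        ∈ ElemSubgroup m (Localization.Away f)) :
    g ∈ ElemSubgroup m (Polynomial A) := by
  rw [mem_elemSubgroup_iff] at h ⊢
  refine mem_elemMonoid_of_polyToLaurent_mem hm (congrArg Subtype.val (mul_inv_cancel g)) ?_
  rw [← IsLocalization.Away.lift_comp (S := Localization.Away f) f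
    (isUnit_polyToLaurent_of_monic hf), ← mapMatrix_mapMatrix]
  exact mapMatrix_mem_elemMonoid _ h
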